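/- arXiv:1801.05484 — 2 statements merged into one kernel-verified Lean document; each statement's English description precedes it below -/
import Mathlib

section
/- Every Carnot group, equipped with its sub-Riemannian (Carnot–Carathéodory) metric and Haar (Lebesgue) measure, supports a 1-Poincaré inequality; consequently it supports a Q-Poincaré inequality, is of locally Q-bounded geometry, and is Q-Loewner, where Q is its homogeneous (Hausdorff) dimension. -/
open MeasureTheory Metric Set ENNReal Filter

noncomputable section

/-- A curve in a metric space: a continuous map defined on a nonempty interval of `ℝ`. -/
structure Curve (X : Type*) [MetricSpace X] where
  carrier : Set ℝ
  nonempty : carrier.Nonempty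
  ordConn : carrier.OrdConnected
  toFun : ℝ → X
  cont : ContinuousOn toFun carrier

namespace Curve

variable {X : Type*} [MetricSpace X]

/-- The length of a curve, as the total variation of its parametrization. -/
def length (γ : Curve X) : ℝ≥0∞ := eVariationOn γ.toFun γ.carrier

/-- A curve is rectifiable if it has finite length. -/
def Rectifiable (γ : Curve X) : Prop := γ.length < ⊤

/-- A curve is locally rectifiable if its restriction to every compact subinterval of its
domain is rectifiable. -/
def LocallyRectifiable (γ : Curve X) : Prop :=
  ∀ a b : ℝ, Set.Icc a b ⊆ γ.carrier → eVariationOn γ.toFun (Set.Icc a b) < ⊤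

/-- The (lower) line integral `∫_γ ρ dl` of a nonnegative Borel function along a curve,
defined through partitions of the parameter interval: on each piece one takes the infimum
of `ρ` along the piece times the length (variation) of the piece. -/
def lineIntegral (γ : Curve X) (ρ : X → ℝ≥0∞) : ℝ≥0∞ :=
  ⨆ (n : ℕ) (t : ℕ → ℝ) (_ : ∀ i, i < n → t i ≤ t (i + 1)) (_ : ∀ i, i ≤ n → t i ∈ γ.carrier),
    ∑ i ∈ Finset.range n,
      (⨅ s ∈ γ.carrier ∩ Set.Icc (t i) (t (i + 1)), ρ (γ.toFun s)) *
        eVariationOn γ.toFun (γ.carrier ∩ Set.Icc (t i) (t (i + 1)))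

/-- `γ'` is a subcurve of `γ`: the restriction of `γ` to a subinterval of its domain. -/
def IsSubcurve (γ' γ : Curve X) : Prop :=
  γ'.carrier ⊆ γ.carrier ∧ Set.EqOn γ'.toFun γ.toFun γ'.carrier

end Curve

variable {X Y : Type*} [MetricSpace X] [MetricSpace Y]

/-- The family `Γ(E,F,U)` of all curves in the set `U` joining `E` and `F`. -/
def joiningCurves (E F U : Set X) : Set (Curve X) :=
  {γ | γ.toFun '' γ.carrier ⊆ U ∧ (∃ s ∈ γ.carrier, γ.toFun s ∈ E) ∧
    ∃ t ∈ γ.carrier, γ.toFun t ∈ F}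

/-- The `p`-modulus of a family of curves: the infimum of `∫ ρ^p dμ` over all nonnegative
Borel functions `ρ` with `∫_γ ρ dl ≥ 1` for every curve `γ` in the family. -/
def modulus [MeasurableSpace X] (μ : Measure X) (p : ℝ) (Γ : Set (Curve X)) : ℝ≥0∞ :=
  ⨅ (ρ : X → ℝ≥0∞) (_ : Measurable ρ) (_ : ∀ γ ∈ Γ, 1 ≤ γ.lineIntegral ρ),
    ∫⁻ x, ρ x ^ p ∂μ

/-- Distance between two sets. -/
def setEDist (E F : Set X) : ℝ≥0∞ := ⨅ x ∈ E, EMetric.infEdist x F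

/-- A continuum is a nonempty compact connected set. -/
def IsContinuum (E : Set X) : Prop := IsCompact E ∧ IsConnected E

/-- A metric measure space is `Q`-Loewner if the `Q`-modulus of the family of curves joining
two disjoint nondegenerate continua is bounded below in terms of their relative distance. -/
def IsLoewner (Q : ℝ) (Y : Type*) [MetricSpace Y] [MeasurableSpace Y] (ν : Measure Y) : Prop :=
  ∃ φ : ℝ → ℝ≥0∞, (∀ s t : ℝ, 0 < s → s ≤ t → φ t ≤ φ s) ∧
    (∀ t : ℝ, 0 < t → 0 < φ t ∧ φ t < ⊤) ∧
    ∀ E F : Set Y, IsContinuum E → E.Nontrivial → IsContinuum F → F.Nontrivial →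
      Disjoint E F → ∀ t : ℝ, 0 < t →
        setEDist E F ≤ ENNReal.ofReal t * min (EMetric.diam E) (EMetric.diam F) →
        φ t ≤ modulus ν Q (joiningCurves E F Set.univ)

/-- A metric measure space is of locally `Q`-bounded geometry if it is separable, pathwise
connected, locally compact, and each point has a relatively compact neighbourhood on which
balls have at most Euclidean-type volume growth of exponent `Q` and the `Q`-modulus of curves
joining two continua in a ball is controlled from below by their relative distance. -/
def LocBoundedGeom (Q : ℝ) (X : Type*) [MetricSpace X] [MeasurableSpace X]
    (μ : Measure X) : Prop :=
  TopologicalSpace.SeparableSpace X ∧ PathConnectedSpace X ∧ LocallyCompactSpace X ∧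
  ∃ (C₀ lam : ℝ) (ψ : ℝ → ℝ≥0∞), 1 ≤ C₀ ∧ 0 < lam ∧ lam ≤ 1 ∧
    (∀ s t : ℝ, 0 < s → s ≤ t → ψ t ≤ ψ s) ∧ (∀ t : ℝ, 0 < t → 0 < ψ t ∧ ψ t < ⊤) ∧
    ∀ x₀ : X, ∃ U : Set X, U ∈ nhds x₀ ∧ IsCompact (closure U) ∧
      (∀ r : ℝ, 0 < r → Metric.ball x₀ r ⊆ U →
        μ (Metric.ball x₀ r) ≤ ENNReal.ofReal (C₀ * r ^ Q)) ∧
      (∀ r : ℝ, 0 < r → Metric.ball x₀ r ⊆ U → ∀ E F : Set X,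
        IsContinuum E → E.Nontrivial → IsContinuum F → F.Nontrivial → Disjoint E F →
        E ⊆ Metric.ball x₀ (lam * r) → F ⊆ Metric.ball x₀ (lam * r) →
        ∀ t : ℝ, 0 < t →
          setEDist E F ≤ ENNReal.ofReal t * min (EMetric.diam E) (EMetric.diam F) →
          ψ t ≤ modulus μ Q (joiningCurves E F (Metric.ball x₀ r)))

/-- The local quasiconformality quotient of `f` at `x ∈ U` at scale `r`. -/
def qcQuot (f : X → Y) (U : Set X) (x : X) (r : ℝ) : ℝ≥0∞ :=
  (⨆ y ∈ {y | y ∈ U ∧ dist x y ≤ r}, edist (f x) (f y)) /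
    ⨅ y ∈ {y | y ∈ U ∧ r ≤ dist x y}, edist (f x) (f y)

/-- Metric definition of quasiconformality: the linear dilatation is at most `H`
at every point of `U`. -/
def IsMetricQC (H : ℝ≥0∞) (f : X → Y) (U : Set X) : Prop :=
  ∀ x ∈ U, Filter.limsup (qcQuot f U x) (nhdsWithin 0 (Set.Ioi 0)) ≤ H

/-- `f` is a homeomorphism of `U` onto `V`. -/
def IsHomeoOn (f : X → Y) (U : Set X) (V : Set Y) : Prop :=
  Set.BijOn f U V ∧ ContinuousOn f U ∧
    ∃ g : Y → X, Set.MapsTo g V U ∧ (∀ x ∈ U, g (f x) = x) ∧ ContinuousOn g V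

/-- The family `f(Γ)` of image curves of a family `Γ` under a map `f`. -/
def mapFamily (f : X → Y) (Γ : Set (Curve X)) : Set (Curve Y) :=
  {γ' | ∃ γ ∈ Γ, γ'.carrier = γ.carrier ∧ ∀ t ∈ γ'.carrier, γ'.toFun t = f (γ.toFun t)}

/-- `g` is an upper gradient of `u`: for every nonconstant rectifiable curve `γ` defined on a
compact interval, `|u(endpoint) - u(startpoint)| ≤ ∫_γ g dl`. -/
def IsUpperGradient {X : Type*} [MetricSpace X] (g : X → ℝ≥0∞) (u : X → ℝ) : Prop :=
  ∀ (γ : Curve X) (a b : ℝ), a ≤ b → γ.carrier = Set.Icc a b → γ.Rectifiable →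
    ¬(∀ s ∈ γ.carrier, γ.toFun s = γ.toFun a) →
    ENNReal.ofReal |u (γ.toFun b) - u (γ.toFun a)| ≤ γ.lineIntegral g

/-- `(X,d,μ)` supports a `p`-Poincaré inequality: averaged oscillation of `u` on a ball is
controlled by `C r` times the `L^p`-average of any upper gradient on the dilated ball. -/
def SupportsPoincare {X : Type*} [MetricSpace X] [MeasurableSpace X]
    (p : ℝ) (μ : Measure X) : Prop :=
  ∃ τ C : ℝ, 0 < τ ∧ 0 < C ∧ ∀ (x : X) (r : ℝ), 0 < r →
    ∀ u : X → ℝ, Measurable u → ∀ g : X → ℝ≥0∞, Measurable g → IsUpperGradient g u →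
      (∫⁻ y in Metric.ball x r, ENNReal.ofReal |u y - ⨍ z in Metric.ball x r, u z ∂μ| ∂μ) /
          μ (Metric.ball x r) ≤
        ENNReal.ofReal (C * r) *
          ((∫⁻ y in Metric.ball x (τ * r), g y ^ p ∂μ) / μ (Metric.ball x (τ * r))) ^ (1 / p)

/-- A local `p`-Poincaré inequality: each point has a neighbourhood scale within which the
Poincaré inequality holds for balls. -/
def SupportsLocalPoincare {X : Type*} [MetricSpace X] [MeasurableSpace X]
    (p : ℝ) (μ : Measure X) : Prop :=
  ∃ τ C : ℝ, 0 < τ ∧ 0 < C ∧ ∀ x₀ : X, ∃ R : ℝ, 0 < R ∧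
    ∀ (x : X) (r : ℝ), 0 < r → x ∈ Metric.ball x₀ R →
      Metric.ball x (τ * r) ⊆ Metric.ball x₀ R →
      ∀ u : X → ℝ, Measurable u → ∀ g : X → ℝ≥0∞, Measurable g → IsUpperGradient g u →
        (∫⁻ y in Metric.ball x r, ENNReal.ofReal |u y - ⨍ z in Metric.ball x r, u z ∂μ| ∂μ) /
            μ (Metric.ball x r) ≤
          ENNReal.ofReal (C * r) *
            ((∫⁻ y in Metric.ball x (τ * r), g y ^ p ∂μ) / μ (Metric.ball x (τ * r))) ^ (1 / p)

/-- Ahlfors `Q`-regularity: balls of radius `r < diam X` have measure comparable to `r^Q`. -/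
def AhlforsRegular {X : Type*} [MetricSpace X] [MeasurableSpace X]
    (Q : ℝ) (μ : Measure X) : Prop :=
  ∃ C : ℝ, 1 ≤ C ∧ ∀ (x : X) (r : ℝ), 0 < r →
    ENNReal.ofReal r < EMetric.diam (Set.univ : Set X) →
      ENNReal.ofReal (r ^ Q) / ENNReal.ofReal C ≤ μ (Metric.ball x r) ∧
        μ (Metric.ball x r) ≤ ENNReal.ofReal (C * r ^ Q)

/-- Local Ahlfors `Q`-regularity: each point has a neighbourhood on which the two-sided
`r^Q` bound holds for balls contained in it. -/
def LocAhlforsRegular {X : Type*} [MetricSpace X] [MeasurableSpace X]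
    (Q : ℝ) (μ : Measure X) : Prop :=
  ∀ x₀ : X, ∃ R C : ℝ, 0 < R ∧ 1 ≤ C ∧
    ∀ x ∈ Metric.ball x₀ R, ∀ r : ℝ, 0 < r → Metric.ball x r ⊆ Metric.ball x₀ R →
      ENNReal.ofReal (r ^ Q) / ENNReal.ofReal C ≤ μ (Metric.ball x r) ∧
        μ (Metric.ball x r) ≤ ENNReal.ofReal (C * r ^ Q)

/-- A Carnot group of homogeneous (Hausdorff) dimension `Q`, axiomatized metrically: a
simply connected, connected, locally compact nilpotent topological group carrying a
left-invariant geodesic (Carnot–Carathéodory) metric, a Haar measure, and a one-parameter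
family of dilating automorphisms scaling distances by `r` and the measure by `r^Q`; its
Hausdorff dimension is the homogeneous dimension `Q`. -/
structure IsCarnotGroup (G : Type*) [Group G] [MetricSpace G] [MeasurableSpace G]
    (μ : Measure G) (Q : ℝ) : Prop where
  continuous_mul : Continuous fun p : G × G => p.1 * p.2
  continuous_inv : Continuous fun g : G => g⁻¹
  connected : ConnectedSpace G
  simplyConnected : SimplyConnectedSpace G
  locallyCompact : LocallyCompactSpace G
  nilpotent : Group.IsNilpotent G
  nontrivial : Nontrivial G
  haar_open_pos : ∀ V : Set G, IsOpen V → V.Nonempty → 0 < μ V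
  haar_left_invariant : ∀ (g : G) (s : Set G), μ ((g * ·) '' s) = μ s
  dist_left_invariant : ∀ g x y : G, dist (g * x) (g * y) = dist x y
  geodesic : ∀ x y : G, ∃ (γ : Curve G) (b : ℝ), 0 ≤ b ∧ γ.carrier = Set.Icc 0 b ∧
    γ.toFun 0 = x ∧ γ.toFun b = y ∧ γ.length = ENNReal.ofReal (dist x y)
  dilation : ∀ r : ℝ, 0 < r → ∃ δ : G ≃* G,
    (∀ x y : G, dist (δ x) (δ y) = r * dist x y) ∧
    ∀ s : Set G, μ (δ '' s) = ENNReal.ofReal (r ^ Q) * μ s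
  hausdorff_dimension : dimH (Set.univ : Set G) = ENNReal.ofReal Q

/-- `X` is a geodesic space: any two points are joined by a `1`-Lipschitz path whose time of
travel is the distance between them. -/
def HasGeodesics (X : Type*) [MetricSpace X] : Prop :=
  ∀ x y : X, ∃ σ : ℝ → X, LipschitzWith 1 σ ∧ σ 0 = x ∧ σ (dist x y) = y

lemma exists_geodesic_of_length_eq {x y : X} {γ : Curve X} {b : ℝ} (hb : 0 ≤ b)
    (hc : γ.carrier = Icc 0 b) (h0 : γ.toFun 0 = x) (h1 : γ.toFun b = y)
    (hl : γ.length = ENNReal.ofReal (dist x y)) :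
    ∃ σ : ℝ → X, LipschitzWith 1 σ ∧ σ 0 = x ∧ σ (dist x y) = y := by
  have key : ∀ s t : ℝ, 0 ≤ s → s ≤ t → t ≤ b →
      dist x (γ.toFun s) + dist (γ.toFun s) (γ.toFun t) + dist (γ.toFun t) y ≤ dist x y := by
    intro s t hs hst ht
    have e1 := eVariationOn.Icc_add_Icc γ.toFun (s := univ) hs hst (mem_univ _)
    have e2 := eVariationOn.Icc_add_Icc γ.toFun (s := univ) (hs.trans hst) ht (mem_univ _)
    simp only [univ_inter] at e1 e2
    have hl' : eVariationOn γ.toFun (Icc 0 b) = ENNReal.ofReal (dist x y) := by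
      rw [← hl, Curve.length, hc]
    have a1 := eVariationOn.edist_le γ.toFun (left_mem_Icc.2 hs) (right_mem_Icc.2 hs)
    have a2 := eVariationOn.edist_le γ.toFun (left_mem_Icc.2 hst) (right_mem_Icc.2 hst)
    have a3 := eVariationOn.edist_le γ.toFun (left_mem_Icc.2 ht) (right_mem_Icc.2 ht)
    have : edist x (γ.toFun s) + edist (γ.toFun s) (γ.toFun t) + edist (γ.toFun t) y
        ≤ ENNReal.ofReal (dist x y) := by
      rw [← hl', ← e2, ← e1, ← h0, ← h1]
      exact add_le_add (add_le_add a1 a2) a3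
    rw [edist_dist, edist_dist, edist_dist, ← ENNReal.ofReal_add dist_nonneg dist_nonneg,
      ← ENNReal.ofReal_add (by positivity) dist_nonneg] at this
    exact (ENNReal.ofReal_le_ofReal_iff dist_nonneg).1 this
  have diff : ∀ s t : ℝ, 0 ≤ s → s ≤ t → t ≤ b →
      dist (γ.toFun s) (γ.toFun t) = dist x (γ.toFun t) - dist x (γ.toFun s) := by
    intro s t hs hst ht
    have h2 := key s t hs hst ht
    have h3 := dist_triangle x (γ.toFun t) y
    have h4 := dist_triangle x (γ.toFun s) (γ.toFun t)
    linarith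
  have diff' : ∀ s t : ℝ, s ∈ Icc 0 b → t ∈ Icc 0 b →
      dist (γ.toFun s) (γ.toFun t) = |dist x (γ.toFun s) - dist x (γ.toFun t)| := by
    intro s t hs ht
    rcases le_total s t with h | h
    · rw [diff s t hs.1 h ht.2, abs_sub_comm, abs_of_nonneg]
      rw [← diff s t hs.1 h ht.2]; exact dist_nonneg
    · rw [dist_comm, diff t s ht.1 h hs.2, abs_of_nonneg]
      rw [← diff t s ht.1 h hs.2]; exact dist_nonneg
  have surj : ∀ τ : Icc (0 : ℝ) (dist x y), ∃ t ∈ Icc 0 b, dist x (γ.toFun t) = τ := by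
    intro τ
    have cont : ContinuousOn (fun t => dist x (γ.toFun t)) (Icc 0 b) :=
      by
      have := hc ▸ γ.cont
      fun_prop
    have := intermediate_value_Icc hb cont
    simp only [h0, h1, dist_self] at this
    exact this τ.2
  choose T hT hT' using surj
  let p := projIcc (0 : ℝ) (dist x y) dist_nonneg
  have hp0 : (p 0 : ℝ) = 0 := by simp [p]
  have hpd : (p (dist x y) : ℝ) = dist x y := by simp [p]
  refine ⟨fun τ => γ.toFun (T (p τ)), ?_, ?_, ?_⟩
  · refine LipschitzWith.of_dist_le_mul fun s t => ?_
    rw [diff' _ _ (hT _) (hT _), hT', hT', NNReal.coe_one, one_mul]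
    exact abs_projIcc_sub_projIcc dist_nonneg
  · have := hT' (p 0)
    rw [hp0, dist_eq_zero] at this
    exact this.symm
  · have h2 := hT' (p (dist x y))
    have h3 := hT (p (dist x y))
    have := key _ _ h3.1 le_rfl h3.2
    rw [h2, hpd, dist_self] at this
    have : dist (γ.toFun (T (p (dist x y)))) y ≤ 0 := by linarith
    exact dist_le_zero.1 this

lemma image_dilation_ball {G : Type*} [Group G] [MetricSpace G] {δ : G ≃* G} {s : ℝ} (hs : 0 < s)
    (hδ : ∀ x y, dist (δ x) (δ y) = s * dist x y) (r : ℝ) :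
    δ '' ball 1 r = ball 1 (s * r) := by
  ext z
  constructor
  · rintro ⟨w, hw, rfl⟩
    rw [mem_ball, ← map_one δ, hδ]
    exact mul_lt_mul_of_pos_left hw hs
  · intro hz
    refine ⟨δ.symm z, ?_, by simp⟩
    have := hδ (δ.symm z) 1
    rw [map_one, MulEquiv.apply_symm_apply] at this
    rw [mem_ball, this] at hz
    exact lt_of_mul_lt_mul_left hz hs.le

namespace IsCarnotGroup

variable {G : Type*} [Group G] [MetricSpace G] [MeasurableSpace G] {μ : Measure G} {Q : ℝ}

lemma hasGeodesics (hG : IsCarnotGroup G μ Q) : HasGeodesics G := fun x y => by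
  obtain ⟨γ, b, hb, hc, h0, h1, hl⟩ := hG.geodesic x y
  exact exists_geodesic_of_length_eq hb hc h0 h1 hl

lemma one_le_dim (hG : IsCarnotGroup G μ Q) : 1 ≤ Q := by
  have := hG.connected
  obtain ⟨y, hy⟩ := (hG.nontrivial).exists_pair_ne
  obtain ⟨z, hz⟩ := hy
  have h1 : dimH (range fun x : G => dist y x) ≤ dimH (univ : Set G) :=
    (LipschitzWith.dist_right y).dimH_range_le
  have h2 : Icc 0 (dist y z) ⊆ range fun x : G => dist y x := by
    have hpre := isPreconnected_range (f := fun x : G => dist y x) (by fun_prop)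
    exact hpre.Icc_subset ⟨y, by simp⟩ ⟨z, rfl⟩
  have h3 : dimH (Icc 0 (dist y z)) = 1 := by
    have := Real.dimH_of_nonempty_interior (s := Icc 0 (dist y z))
    simpa [hz] using this
  have h4 := (dimH_mono h2).trans h1
  rw [h3, hG.hausdorff_dimension] at h4
  exact ENNReal.one_le_ofReal.1 h4

lemma dim_pos (hG : IsCarnotGroup G μ Q) : 0 < Q := by linarith [hG.one_le_dim]

lemma isTopologicalGroup (hG : IsCarnotGroup G μ Q) : IsTopologicalGroup G where
  continuous_mul := hG.continuous_mul
  continuous_inv := hG.continuous_inv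

lemma image_mul_ball (hG : IsCarnotGroup G μ Q) (x y : G) (r : ℝ) :
    (x * ·) '' ball y r = ball (x * y) r := by
  ext z
  constructor
  · rintro ⟨w, hw, rfl⟩
    simpa [mem_ball, hG.dist_left_invariant] using hw
  · intro hz
    refine ⟨x⁻¹ * z, ?_, by simp⟩
    rw [mem_ball, ← hG.dist_left_invariant x]
    simpa using hz

lemma measure_ball_eq (hG : IsCarnotGroup G μ Q) (x : G) {r : ℝ} (hr : 0 < r) :
    μ (ball x r) = ENNReal.ofReal (r ^ Q) * μ (ball 1 1) := by
  obtain ⟨δ, h1, h2⟩ := hG.dilation r hr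
  rw [← h2, image_dilation_ball hr h1, mul_one, ← hG.haar_left_invariant x (ball 1 r),
    hG.image_mul_ball, mul_one]

lemma properSpace (hG : IsCarnotGroup G μ Q) : ProperSpace G := by
  have := hG.locallyCompact
  obtain ⟨ε, hε, hK⟩ := (exists_isCompact_closedBall (1 : G))
  refine ProperSpace.of_seq_closedBall (x := (1 : G)) (r := fun n : ℕ => (n : ℝ))
    tendsto_natCast_atTop_atTop (Eventually.of_forall fun n => ?_)
  have hs : 0 < (n + 1 : ℝ) / ε := by positivity
  obtain ⟨δ, h1, -⟩ := hG.dilation _ hs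
  have hc : Continuous δ :=
    (LipschitzWith.of_dist_le_mul (K := ⟨_, hs.le⟩) fun x y => (h1 x y).le).continuous
  refine (hK.image hc).of_isClosed_subset isClosed_closedBall fun z hz => ⟨δ.symm z, ?_, by simp⟩
  have := h1 (δ.symm z) 1
  rw [map_one, MulEquiv.apply_symm_apply] at this
  rw [mem_closedBall] at hz ⊢
  rw [this, div_mul_eq_mul_div, div_le_iff₀ hε] at hz
  have h3 : (n + 1 : ℝ) * dist (δ.symm z) 1 ≤ (n + 1) * ε := by nlinarith
  exact le_of_mul_le_mul_left h3 (by positivity)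

variable [BorelSpace G] [IsLocallyFiniteMeasure μ]

lemma exists_measure_ball_eq (hG : IsCarnotGroup G μ Q) :
    ∃ V : ℝ, 0 < V ∧ ∀ (x : G) (r : ℝ), 0 < r → μ (ball x r) = ENNReal.ofReal (V * r ^ Q) := by
  have := hG.properSpace
  have hpos : 0 < μ (ball (1 : G) 1) := hG.haar_open_pos _ isOpen_ball ⟨1, by simp⟩
  have hfin : μ (ball (1 : G) 1) < ⊤ := measure_ball_lt_top
  refine ⟨(μ (ball (1 : G) 1)).toReal, ENNReal.toReal_pos hpos.ne' hfin.ne, fun x r hr => ?_⟩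
  rw [hG.measure_ball_eq x hr, mul_comm, ENNReal.ofReal_mul ENNReal.toReal_nonneg,
    ENNReal.ofReal_toReal hfin.ne]

lemma isHaarMeasure (hG : IsCarnotGroup G μ Q) : μ.IsHaarMeasure where
  lt_top_of_isCompact := fun _ hK => hK.measure_lt_top
  map_mul_left_eq_self g := by
    have := hG.isTopologicalGroup
    ext s hs
    rw [Measure.map_apply (measurable_const_mul g) hs, ← hG.haar_left_invariant g,
      image_preimage_eq _ (Group.mulLeft_bijective g).surjective]
  open_pos U hU hne := (hG.haar_open_pos U hU hne).ne'

/-- A dilation carries the modular character to itself, and the modular character is bounded on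
the unit ball, so it is trivial. -/
lemma isMulRightInvariant [TopologicalSpace.SeparableSpace G] (hG : IsCarnotGroup G μ Q) :
    μ.IsMulRightInvariant := by
  have := hG.isTopologicalGroup
  have := hG.isHaarMeasure
  have := hG.properSpace
  have := UniformSpace.secondCountable_of_separable G
  have hpos : 0 < μ (ball (1 : G) 1) := hG.haar_open_pos _ isOpen_ball ⟨1, by simp⟩
  have hfin : μ (ball (1 : G) 1) < ⊤ := measure_ball_lt_top
  have hmap (g : G) : μ.map (· * g) = Measure.modularCharacter g • μ :=
    Measure.map_right_mul_eq_modularCharacterFun_smul μ g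
  have hbd : ∀ g : G, (Measure.modularCharacter g : ℝ≥0∞) ≤ ENNReal.ofReal (2 ^ Q) := by
    intro g
    set s : ℝ := dist 1 g + 1 with hs_def
    have hs : 0 < s := by positivity
    obtain ⟨δ, h1, h2⟩ := hG.dilation s hs
    set h := δ.symm g with hh_def
    have hδh : δ h = g := by simp [h]
    have hh : dist 1 h < 1 := by
      have := h1 1 h
      rw [map_one, hδh] at this
      by_contra! hcon
      nlinarith
    have hpre : (· * g) ⁻¹' (ball 1 s) = δ '' ((· * h) ⁻¹' ball 1 1) := by
      ext z
      rw [show ball (1 : G) s = δ '' ball 1 1 by rw [image_dilation_ball hs h1, mul_one]]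
      constructor
      · rintro ⟨w, hw, hwz⟩
        refine ⟨w * h⁻¹, by simpa using hw, ?_⟩
        rw [map_mul, map_inv, hδh, hwz]
        simp
      · rintro ⟨w, hw, rfl⟩
        exact ⟨w * h, hw, by simp [hδh]⟩
    have hle : μ ((· * g) ⁻¹' (ball 1 s)) ≤
        ENNReal.ofReal (s ^ Q) * (ENNReal.ofReal (2 ^ Q) * μ (ball 1 1)) := by
      rw [hpre, h2]
      gcongr
      rw [← hG.measure_ball_eq 1 two_pos]
      refine measure_mono fun w hw => ?_
      rw [mem_preimage, mem_ball] at hw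
      rw [mem_ball]
      have : dist w (w * h) = dist 1 h := by
        rw [← hG.dist_left_invariant w 1 h, mul_one]
      linarith [dist_triangle w (w * h) 1]
    rw [← Measure.map_apply (measurable_mul_const g) measurableSet_ball, hmap,
      Measure.smul_apply, hG.measure_ball_eq 1 hs, ENNReal.smul_def, smul_eq_mul] at hle
    have hc : ENNReal.ofReal (s ^ Q) * μ (ball (1 : G) 1) ≠ 0 :=
      mul_ne_zero (by simpa using Real.rpow_pos_of_pos hs Q) hpos.ne'
    refine (ENNReal.mul_le_mul_iff_left hc (ENNReal.mul_ne_top ofReal_ne_top hfin.ne)).1 ?_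
    calc _ ≤ _ := hle
      _ = _ := by ring
  have hle1 : ∀ g : G, Measure.modularCharacter g ≤ 1 := by
    intro g
    by_contra! hcon
    obtain ⟨n, hn⟩ := pow_unbounded_of_one_lt ((2 : ℝ) ^ Q).toNNReal hcon
    have := hbd (g ^ n)
    rw [map_pow, ENNReal.ofReal, ENNReal.coe_le_coe] at this
    exact absurd hn this.not_gt
  refine ⟨fun g => ?_⟩
  have h1 : Measure.modularCharacter g = 1 := by
    refine le_antisymm (hle1 g) ?_
    have h2 : Measure.modularCharacter g * Measure.modularCharacter g⁻¹ = 1 := by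
      rw [← map_mul, mul_inv_cancel, map_one]
    calc (1 : NNReal) = Measure.modularCharacter g * Measure.modularCharacter g⁻¹ := h2.symm
      _ ≤ Measure.modularCharacter g := mul_le_of_le_one_right' (hle1 _)
  rw [hmap, h1, one_smul]

end IsCarnotGroup

/-- `g` bounds the oscillation of `u` along `1`-Lipschitz paths, with the integral of `g` taken
with respect to time. -/
def IsPathGradient (g : X → ℝ≥0∞) (u : X → ℝ) : Prop :=
  ∀ σ : ℝ → X, LipschitzWith 1 σ → ∀ L : ℝ, 0 ≤ L →
    ENNReal.ofReal |u (σ L) - u (σ 0)| ≤ ∫⁻ t in Icc 0 L, g (σ t)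

lemma eVariationOn_Icc_le_of_lipschitzWith {σ : ℝ → X} (hσ : LipschitzWith 1 σ) {a b : ℝ}
    (hab : a ≤ b) : eVariationOn σ (Icc a b) ≤ ENNReal.ofReal (b - a) := by
  have h1 := (hσ.lipschitzOnWith (s := univ)).comp_eVariationOn_le (f := σ) (g := id)
    (s := Icc a b) (mapsTo_univ _ _)
  have h2 := (monotone_id (α := ℝ)).monotoneOn (Icc a b) |>.eVariationOn_eq
    (left_mem_Icc.2 hab) (right_mem_Icc.2 hab)
  rw [inter_self] at h2
  simpa using h1.trans (mul_le_mul_right h2.le _)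

/-- Along a `1`-Lipschitz path the lower line integral is at most the time integral. -/
lemma Curve.lineIntegral_le_lintegral {γ : Curve X} (hγ : LipschitzWith 1 γ.toFun) {a b : ℝ}
    (hc : γ.carrier = Icc a b) (ρ : X → ℝ≥0∞) :
    γ.lineIntegral ρ ≤ ∫⁻ t in Icc a b, ρ (γ.toFun t) := by
  refine iSup_le fun n => iSup_le fun t => iSup_le fun ht => iSup_le fun hmem => ?_
  have key : ∀ m ≤ n, t 0 ≤ t m ∧
      ∑ i ∈ Finset.range m, (⨅ s ∈ γ.carrier ∩ Icc (t i) (t (i + 1)), ρ (γ.toFun s)) *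
        eVariationOn γ.toFun (γ.carrier ∩ Icc (t i) (t (i + 1)))
      ≤ ∫⁻ s in Ioc (t 0) (t m), ρ (γ.toFun s) := by
    intro m
    induction m with
    | zero => simp
    | succ m ih =>
      intro hm
      obtain ⟨h0, h1⟩ := ih (by omega)
      have h2 := ht m (by omega)
      refine ⟨h0.trans h2, ?_⟩
      have hsub : Icc (t m) (t (m + 1)) ⊆ γ.carrier :=
        γ.ordConn.out (hmem m (by omega)) (hmem (m + 1) hm)
      rw [Finset.sum_range_succ, ← Ioc_union_Ioc_eq_Ioc h0 h2,
        lintegral_union measurableSet_Ioc (Ioc_disjoint_Ioc_of_le le_rfl),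
        inter_eq_right.2 hsub]
      refine add_le_add h1 ?_
      calc _ ≤ (⨅ s ∈ Icc (t m) (t (m + 1)), ρ (γ.toFun s)) *
            ENNReal.ofReal (t (m + 1) - t m) := by
            gcongr
            exact eVariationOn_Icc_le_of_lipschitzWith hγ h2
        _ = ∫⁻ _ in Ioc (t m) (t (m + 1)), ⨅ s ∈ Icc (t m) (t (m + 1)), ρ (γ.toFun s) := by
            simp
        _ ≤ _ := setLIntegral_mono' measurableSet_Ioc fun s hs =>
            iInf₂_le s (Ioc_subset_Icc_self hs)
  refine (key n le_rfl).2.trans (lintegral_mono_set ?_)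
  have h0 := hmem 0 (Nat.zero_le n)
  have hn := hmem n le_rfl
  rw [hc] at h0 hn
  exact Ioc_subset_Icc_self.trans (Icc_subset_Icc h0.1 hn.2)

lemma IsUpperGradient.isPathGradient {g : X → ℝ≥0∞} {u : X → ℝ} (h : IsUpperGradient g u) :
    IsPathGradient g u := by
  intro σ hσ L hL
  let γ : Curve X := ⟨Icc 0 L, nonempty_Icc.2 hL, ordConnected_Icc, σ, hσ.continuous.continuousOn⟩
  by_cases hconst : ∀ s ∈ γ.carrier, γ.toFun s = γ.toFun 0
  · have : σ L = σ 0 := hconst L (right_mem_Icc.2 hL)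
    simp [this]
  · refine (h γ 0 L hL rfl ?_ hconst).trans (Curve.lineIntegral_le_lintegral hσ rfl g)
    exact (eVariationOn_Icc_le_of_lipschitzWith hσ hL).trans_lt ofReal_lt_top

section averages

variable {Ω : Type*} [MeasurableSpace Ω] {μ : Measure Ω}

lemma integrable_of_lintegral_lintegral_sub_ne_top [IsFiniteMeasure μ] [NeZero μ] {u : Ω → ℝ}
    (hu : Measurable u) (h : ∫⁻ y, ∫⁻ z, ENNReal.ofReal |u y - u z| ∂μ ∂μ ≠ ⊤) :
    Integrable u μ := by
  have hm : Measurable fun y => ∫⁻ z, ENNReal.ofReal |u y - u z| ∂μ := by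
    refine Measurable.lintegral_prod_right (f := fun y z => ENNReal.ofReal |u y - u z|) ?_
    fun_prop
  obtain ⟨y, hy⟩ := (ae_lt_top hm h).exists
  have : Integrable (fun z => u y - u z) μ := by
    refine ⟨by fun_prop, ?_⟩
    rw [hasFiniteIntegral_iff_norm]
    simpa [Real.norm_eq_abs] using hy
  refine ((integrable_const (u y)).sub this).congr (ae_of_all _ fun z => ?_)
  simp

lemma ofReal_abs_sub_average_le [IsFiniteMeasure μ] [NeZero μ] {u : Ω → ℝ} (hu : Integrable u μ)
    (c : ℝ) :
    ENNReal.ofReal |c - ⨍ z, u z ∂μ| ≤ (∫⁻ z, ENNReal.ofReal |c - u z| ∂μ) / μ univ := by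
  have h1 : c - ⨍ z, u z ∂μ = ⨍ z, (c - u z) ∂μ := by
    rw [average_eq, average_eq, integral_sub (integrable_const c) hu, integral_const, smul_sub,
      smul_smul, inv_mul_cancel₀, one_smul]
    exact measureReal_univ_ne_zero
  rw [h1, average_eq', ← Real.norm_eq_abs, ENNReal.div_eq_inv_mul, ← smul_eq_mul,
    ← lintegral_smul_measure]
  refine (ofReal_le_ofReal (norm_integral_le_lintegral_norm _)).trans ?_
  exact ofReal_toReal_le

lemma lintegral_abs_sub_average_le {s : Set Ω} (hs0 : μ s ≠ 0) (hs : μ s ≠ ⊤) {u : Ω → ℝ}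
    (hu : Measurable u) :
    (∫⁻ y in s, ENNReal.ofReal |u y - ⨍ z in s, u z ∂μ| ∂μ) / μ s ≤
      (∫⁻ y in s, ∫⁻ z in s, ENNReal.ofReal |u y - u z| ∂μ ∂μ) / μ s / μ s := by
  have : Fact (μ s < ⊤) := ⟨hs.lt_top⟩
  have : NeZero (μ.restrict s) := ⟨by simpa using hs0⟩
  gcongr
  by_cases h : ∫⁻ y in s, ∫⁻ z in s, ENNReal.ofReal |u y - u z| ∂μ ∂μ = ⊤
  · rw [h, ENNReal.top_div_of_ne_top hs]; exact le_top
  have hint := integrable_of_lintegral_lintegral_sub_ne_top hu h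
  rw [ENNReal.div_eq_inv_mul, ← lintegral_const_mul' _ _ (by simpa using hs0)]
  refine lintegral_mono fun y => ?_
  have := ofReal_abs_sub_average_le hint (u y)
  rwa [Measure.restrict_apply_univ, ENNReal.div_eq_inv_mul] at this

/-- Jensen's inequality for averages over a set. -/
lemma setLIntegral_div_le_rpow {s : Set Ω} (hs0 : μ s ≠ 0) (hs : μ s ≠ ⊤) {p : ℝ} (hp : 1 ≤ p)
    {g : Ω → ℝ≥0∞} (hg : Measurable g) :
    (∫⁻ y in s, g y ∂μ) / μ s ≤ ((∫⁻ y in s, g y ^ p ∂μ) / μ s) ^ (1 / p) := by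
  set ν := (μ s)⁻¹ • μ.restrict s with hν
  have : IsProbabilityMeasure ν := ⟨by simp [hν, ENNReal.inv_mul_cancel hs0 hs]⟩
  have h := eLpNorm'_le_eLpNorm'_of_exponent_le (μ := ν) one_pos hp
    (f := g) hg.aestronglyMeasurable
  have e (f : Ω → ℝ≥0∞) : (∫⁻ y in s, f y ∂μ) / μ s = ∫⁻ y, f y ∂ν := by
    rw [hν, lintegral_smul_measure, smul_eq_mul, ENNReal.div_eq_inv_mul]
  rw [e, e]
  simpa [eLpNorm'] using h

end averages

namespace IsCarnotGroup

variable {G : Type*} [Group G] [MetricSpace G] [MeasurableSpace G] {μ : Measure G} {Q : ℝ}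
  [BorelSpace G] [IsLocallyFiniteMeasure μ] [TopologicalSpace.SeparableSpace G]

lemma setLIntegral_abs_sub_mul_right_le (hG : IsCarnotGroup G μ Q) {u : G → ℝ}
    {g : G → ℝ≥0∞} (hg : Measurable g) (h : IsPathGradient g u) (x z : G) (r : ℝ)
    (hz : dist 1 z < 2 * r) :
    ∫⁻ y in ball x r, ENNReal.ofReal |u y - u (y * z)| ∂μ ≤
      ENNReal.ofReal (2 * r) * ∫⁻ y in ball x (3 * r), g y ∂μ := by
  have := hG.isTopologicalGroup
  have := UniformSpace.secondCountable_of_separable G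
  have := hG.isHaarMeasure
  have := hG.isMulRightInvariant
  have := hG.properSpace
  obtain ⟨σ, hσ, hσ0, hσ1⟩ := hG.hasGeodesics 1 z
  set d := dist 1 z
  have hpath (y : G) : ENNReal.ofReal |u y - u (y * z)| ≤ ∫⁻ t in Icc 0 d, g (y * σ t) := by
    have := h (fun t => y * σ t) (LipschitzWith.of_dist_le_mul fun s t => by
      rw [hG.dist_left_invariant]; exact hσ.dist_le_mul s t) d dist_nonneg
    simpa [hσ0, hσ1, abs_sub_comm] using this
  have hmeas : Measurable fun p : G × ℝ => g (p.1 * σ p.2) := by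
    have := hσ.continuous
    exact hg.comp (by fun_prop)
  calc ∫⁻ y in ball x r, ENNReal.ofReal |u y - u (y * z)| ∂μ
      ≤ ∫⁻ y in ball x r, (∫⁻ t in Icc 0 d, g (y * σ t)) ∂μ := lintegral_mono hpath
    _ = ∫⁻ t in Icc 0 d, ∫⁻ y in ball x r, g (y * σ t) ∂μ :=
        lintegral_lintegral_swap hmeas.aemeasurable
    _ ≤ ∫⁻ _ in Icc 0 d, ∫⁻ y in ball x (3 * r), g y ∂μ := by
        refine setLIntegral_mono' measurableSet_Icc fun t ht => ?_
        rw [← lintegral_indicator measurableSet_ball, ← lintegral_indicator measurableSet_ball,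
          ← lintegral_mul_right_eq_self (μ := μ) ((ball x (3 * r)).indicator g) (σ t)]
        refine lintegral_mono fun y => ?_
        by_cases hy : y ∈ ball x r
        · have hy' : y * σ t ∈ ball x (3 * r) := by
            have h1 : dist (y * σ t) y ≤ d := by
              calc dist (y * σ t) y = dist (y * σ t) (y * σ 0) := by rw [hσ0, mul_one]
                _ = dist (σ t) (σ 0) := hG.dist_left_invariant _ _ _
                _ ≤ 1 * dist t 0 := hσ.dist_le_mul t 0
                _ ≤ d := by simpa [abs_of_nonneg ht.1] using ht.2
            rw [mem_ball] at hy ⊢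
            linarith [dist_triangle (y * σ t) y x]
          simp [indicator_of_mem hy, indicator_of_mem hy']
        · simp [indicator_of_notMem hy]
    _ = ENNReal.ofReal d * ∫⁻ y in ball x (3 * r), g y ∂μ := by
        rw [setLIntegral_const, Real.volume_Icc, sub_zero, mul_comm]
    _ ≤ _ := by gcongr

lemma lintegral_lintegral_abs_sub_le (hG : IsCarnotGroup G μ Q) {u : G → ℝ} (hu : Measurable u)
    {g : G → ℝ≥0∞} (hg : Measurable g) (h : IsPathGradient g u) (x : G) (r : ℝ) :
    ∫⁻ y in ball x r, ∫⁻ z in ball x r, ENNReal.ofReal |u y - u z| ∂μ ∂μ ≤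
      μ (ball 1 (2 * r)) * (ENNReal.ofReal (2 * r) * ∫⁻ y in ball x (3 * r), g y ∂μ) := by
  have := hG.isTopologicalGroup
  have := UniformSpace.secondCountable_of_separable G
  have := hG.isHaarMeasure
  have := hG.properSpace
  let F : G → G → ℝ≥0∞ := fun y z =>
    (ball x r).indicator (fun _ => ENNReal.ofReal |u y - u z|) z
  have hF : Measurable fun p : G × G => F p.1 (p.1 * p.2) := by
    have hm : Measurable fun p : G × G => ENNReal.ofReal |u p.1 - u (p.1 * p.2)| := by
      have := hu.comp (measurable_mul (M := G))
      simp only [Function.comp_def] at this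
      fun_prop
    exact hm.indicator (measurable_mul (M := G) measurableSet_ball)
  calc ∫⁻ y in ball x r, ∫⁻ z in ball x r, ENNReal.ofReal |u y - u z| ∂μ ∂μ
      = ∫⁻ y in ball x r, ∫⁻ z, F y (y * z) ∂μ ∂μ := by
        refine lintegral_congr fun y => ?_
        rw [lintegral_mul_left_eq_self (F y) y, ← lintegral_indicator measurableSet_ball]
        rfl
    _ = ∫⁻ z, ∫⁻ y in ball x r, F y (y * z) ∂μ ∂μ :=
        lintegral_lintegral_swap hF.aemeasurable
    _ ≤ ∫⁻ z, (ball 1 (2 * r)).indicator (fun _ => ENNReal.ofReal (2 * r) *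
          ∫⁻ y in ball x (3 * r), g y ∂μ) z ∂μ := by
        refine lintegral_mono fun z => ?_
        by_cases hz : z ∈ ball (1 : G) (2 * r)
        · rw [indicator_of_mem hz]
          refine (lintegral_mono fun y => ?_).trans
            (hG.setLIntegral_abs_sub_mul_right_le hg h x z r (by rwa [dist_comm]))
          exact indicator_apply_le fun _ => le_rfl
        · rw [indicator_of_notMem hz]
          refine le_of_eq (setLIntegral_eq_zero measurableSet_ball fun y hy =>
            indicator_of_notMem (fun hyz => hz ?_) _)
          rw [mem_ball, dist_comm, ← hG.dist_left_invariant y, mul_one]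
          rw [mem_ball] at hy hyz
          linarith [dist_triangle_right y (y * z) x]
    _ = _ := by rw [lintegral_indicator_const measurableSet_ball, mul_comm]

/-- The `1`-Poincaré inequality for path gradients. -/
lemma exists_poincare (hG : IsCarnotGroup G μ Q) :
    ∃ K : ℝ, 0 < K ∧ ∀ (x : G) (r : ℝ), 0 < r → ∀ u : G → ℝ, Measurable u →
      ∀ g : G → ℝ≥0∞, Measurable g → IsPathGradient g u →
      (∫⁻ y in ball x r, ENNReal.ofReal |u y - ⨍ z in ball x r, u z ∂μ| ∂μ) / μ (ball x r) ≤
        ENNReal.ofReal (K * r) * ((∫⁻ y in ball x (3 * r), g y ∂μ) / μ (ball x (3 * r))) := by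
  obtain ⟨V, hV, hball⟩ := hG.exists_measure_ball_eq
  refine ⟨2 * 2 ^ Q * 3 ^ Q, by positivity, fun x r hr u hu g hg h => ?_⟩
  have hp : 0 < V * r ^ Q := by positivity
  refine (lintegral_abs_sub_average_le (by rw [hball x r hr]; simpa using hp)
    (by rw [hball x r hr]; exact ofReal_ne_top) hu).trans ?_
  have h1 := hG.lintegral_lintegral_abs_sub_le hu hg h x r
  set I := ∫⁻ y in ball x (3 * r), g y ∂μ
  rw [hball 1 (2 * r) (by positivity)] at h1
  rw [hball x r hr, hball x (3 * r) (by positivity)]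
  refine (ENNReal.div_le_div_right (ENNReal.div_le_div_right h1 _) _).trans (le_of_eq ?_)
  simp only [ENNReal.div_eq_inv_mul]
  rw [← ENNReal.ofReal_inv_of_pos hp, ← ENNReal.ofReal_inv_of_pos (by positivity)]
  simp only [← mul_assoc]
  rw [← ENNReal.ofReal_mul (by positivity), ← ENNReal.ofReal_mul (by positivity),
    ← ENNReal.ofReal_mul (by positivity), ← ENNReal.ofReal_mul (by positivity)]
  congr 2
  rw [Real.mul_rpow two_pos.le hr.le, Real.mul_rpow three_pos.le hr.le]
  have : r ^ Q ≠ 0 := by positivity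
  field_simp

lemma supportsPoincare (hG : IsCarnotGroup G μ Q) {p : ℝ} (hp : 1 ≤ p) : SupportsPoincare p μ := by
  obtain ⟨K, hK, H⟩ := hG.exists_poincare
  obtain ⟨V, hV, hball⟩ := hG.exists_measure_ball_eq
  refine ⟨3, K, three_pos, hK, fun x r hr u hu g hg h => ?_⟩
  refine (H x r hr u hu g hg h.isPathGradient).trans ?_
  gcongr
  refine setLIntegral_div_le_rpow ?_ ?_ hp hg <;> rw [hball x _ (by positivity)]
  · have : 0 < V * (3 * r) ^ Q := by positivity
    simpa using this
  · exact ofReal_ne_top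

end IsCarnotGroup

/-- The paths considered in the definition of `pathCost`: the `1`-Lipschitz paths from `E` to `x`,
together with their time of travel. -/
def pathsFrom (E : Set X) (x : X) : Set ((ℝ → X) × ℝ) :=
  {p | LipschitzWith 1 p.1 ∧ 0 ≤ p.2 ∧ p.1 0 ∈ E ∧ p.1 p.2 = x}

/-- The least cost of travelling from `E` to `x`, when the cost per unit time is `g`. -/
def pathCost (g : X → ℝ≥0∞) (E : Set X) (x : X) : ℝ≥0∞ :=
  ⨅ p : pathsFrom E x, ∫⁻ t in Icc 0 p.1.2, g (p.1.1 t)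

lemma pathCost_le {g : X → ℝ≥0∞} {E : Set X} {f : ℝ → X} (hf : LipschitzWith 1 f) {L : ℝ}
    (hL : 0 ≤ L) (h0 : f 0 ∈ E) : pathCost g E (f L) ≤ ∫⁻ t in Icc 0 L, g (f t) :=
  iInf_le_of_le ⟨(f, L), hf, hL, h0, rfl⟩ le_rfl

lemma lipschitzWith_concat {f σ : ℝ → X} (hf : LipschitzWith 1 f) (hσ : LipschitzWith 1 σ)
    {a : ℝ} (h : σ 0 = f a) :
    LipschitzWith 1 fun t => if t ≤ a then f t else σ (t - a) := by
  have aux : ∀ s t : ℝ, s ≤ t → dist (if s ≤ a then f s else σ (s - a))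
      (if t ≤ a then f t else σ (t - a)) ≤ t - s := by
    intro s t hst
    split_ifs with hs ht ht
    · simpa [Real.dist_eq, abs_sub_comm s t, abs_of_nonneg (sub_nonneg.2 hst)]
        using hf.dist_le_mul s t
    · have h1 := hf.dist_le_mul s a
      have h2 := hσ.dist_le_mul 0 (t - a)
      have h3 := dist_triangle (f s) (f a) (σ (t - a))
      rw [Real.dist_eq, abs_sub_comm, abs_of_nonneg (by linarith)] at h1 h2
      rw [h] at h2
      simp only [NNReal.coe_one] at h1 h2
      linarith
    · linarith
    · have h1 := hσ.dist_le_mul (s - a) (t - a)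
      rw [Real.dist_eq, abs_sub_comm, abs_of_nonneg (by linarith)] at h1
      simp only [NNReal.coe_one] at h1
      linarith
  refine LipschitzWith.of_dist_le_mul fun s t => ?_
  rw [NNReal.coe_one, one_mul, Real.dist_eq]
  rcases le_total s t with h | h
  · rw [abs_sub_comm, abs_of_nonneg (sub_nonneg.2 h)]
    exact aux s t h
  · rw [dist_comm, abs_of_nonneg (sub_nonneg.2 h)]
    exact aux t s h

lemma setLIntegral_concat_le {Z : Type*} {f σ : ℝ → Z} (g : Z → ℝ≥0∞) {a b : ℝ} (ha : 0 ≤ a) (hb : 0 ≤ b) :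
    ∫⁻ t in Icc 0 (a + b), g (if t ≤ a then f t else σ (t - a)) ≤
      (∫⁻ t in Icc 0 a, g (f t)) + ∫⁻ t in Icc 0 b, g (σ t) := by
  rw [← Icc_union_Ioc_eq_Icc ha (le_add_of_nonneg_right hb)]
  refine (lintegral_union_le _ _ _).trans (add_le_add (le_of_eq ?_) ?_)
  · exact setLIntegral_congr_fun measurableSet_Icc fun t ht => by simp [ht.2]
  · rw [← lintegral_indicator measurableSet_Ioc, ← lintegral_indicator measurableSet_Icc,
      ← lintegral_sub_right_eq_self (μ := volume) ((Icc 0 b).indicator fun t => g (σ t)) a]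
    refine lintegral_mono fun t => ?_
    by_cases ht : t ∈ Ioc a (a + b)
    · have ht' : t - a ∈ Icc 0 b := ⟨by linarith [ht.1], by linarith [ht.2]⟩
      rw [indicator_of_mem ht, indicator_of_mem ht', if_neg (not_le.2 ht.1)]
    · rw [indicator_of_notMem ht]
      exact zero_le

lemma pathCost_le_add (g : X → ℝ≥0∞) (E : Set X) {σ : ℝ → X} (hσ : LipschitzWith 1 σ) {L : ℝ}
    (hL : 0 ≤ L) :
    pathCost g E (σ L) ≤ pathCost g E (σ 0) + ∫⁻ t in Icc 0 L, g (σ t) := by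
  rw [pathCost.eq_def g E (σ 0), ENNReal.iInf_add]
  refine le_iInf fun ⟨⟨f, a⟩, hf, ha, h0, h1⟩ => ?_
  simp only at hf ha h0 h1 ⊢
  refine le_trans ?_ (setLIntegral_concat_le g ha hL)
  have := pathCost_le (g := g) (E := E) (lipschitzWith_concat hf hσ h1.symm) (add_nonneg ha hL)
    (by simpa [ha] using h0)
  rcases hL.eq_or_lt with rfl | hL'
  · simpa [h1] using this
  · simpa [hL'.not_ge] using this

lemma setLIntegral_reverse (φ : ℝ → ℝ≥0∞) (L : ℝ) :
    ∫⁻ t in Icc 0 L, φ (L - t) = ∫⁻ t in Icc 0 L, φ t := by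
  rw [← lintegral_indicator measurableSet_Icc, ← lintegral_indicator measurableSet_Icc,
    ← lintegral_sub_left_eq_self (μ := volume) ((Icc 0 L).indicator φ) L]
  refine lintegral_congr fun t => ?_
  simp only [indicator_apply, mem_Icc, sub_nonneg, sub_le_self_iff]
  simp only [and_comm]

lemma pathCost_eq_zero (g : X → ℝ≥0∞) {E : Set X} {x : X} (hx : x ∈ E) : pathCost g E x = 0 := by
  have := pathCost_le (g := g) (E := E) (f := fun _ : ℝ => x) (L := 0)
    (LipschitzWith.const' x) le_rfl hx
  simpa using this

lemma pathCost_ne_top (hX : HasGeodesics X) {g : X → ℝ≥0∞} {M : NNReal} (hg : ∀ x, g x ≤ M)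
    {E : Set X} (hE : E.Nonempty) (x : X) : pathCost g E x ≠ ⊤ := by
  obtain ⟨e, he⟩ := hE
  obtain ⟨σ, hσ, h0, h1⟩ := hX e x
  have h2 := pathCost_le (g := g) hσ dist_nonneg (h0 ▸ he) (L := dist e x)
  rw [h1] at h2
  refine ne_top_of_le_ne_top ?_ (h2.trans (lintegral_mono fun t => hg _))
  rw [setLIntegral_const, Real.volume_Icc]
  exact ENNReal.mul_ne_top coe_ne_top ofReal_ne_top

lemma isPathGradient_pathCost (hX : HasGeodesics X) {g : X → ℝ≥0∞} {M : NNReal}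
    (hg : ∀ x, g x ≤ M) {E : Set X} (hE : E.Nonempty) :
    IsPathGradient g fun x => (pathCost g E x).toReal := by
  intro σ hσ L hL
  have hfin := pathCost_ne_top hX hg hE
  have h1 := pathCost_le_add g E hσ hL
  have hσ' : LipschitzWith 1 fun t => σ (L - t) := LipschitzWith.of_dist_le_mul fun s t => by
    exact (hσ.dist_le_mul (L - s) (L - t)).trans_eq (by rw [dist_sub_left])
  have h2 := pathCost_le_add g E hσ' hL
  rw [setLIntegral_reverse (fun t => g (σ t))] at h2
  simp only [sub_self, sub_zero] at h2
  set I := ∫⁻ t in Icc 0 L, g (σ t)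
  by_cases hI : I = ⊤
  · rw [hI]; exact le_top
  refine ofReal_le_of_le_toReal (abs_sub_le_iff.2 ⟨?_, ?_⟩)
  · rw [sub_le_iff_le_add', ← toReal_add (hfin _) hI]
    exact toReal_mono (add_ne_top.2 ⟨hfin _, hI⟩) h1
  · rw [sub_le_iff_le_add', ← toReal_add (hfin _) hI]
    exact toReal_mono (add_ne_top.2 ⟨hfin _, hI⟩) h2

lemma IsPathGradient.lipschitzWith (hX : HasGeodesics X) {g : X → ℝ≥0∞} {u : X → ℝ}
    (h : IsPathGradient g u) {M : NNReal} (hg : ∀ x, g x ≤ M) : LipschitzWith M u := by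
  intro x y
  obtain ⟨σ, hσ, h0, h1⟩ := hX x y
  have := h σ hσ (dist x y) dist_nonneg
  rw [h0, h1] at this
  rw [edist_comm, edist_dist, Real.dist_eq]
  refine this.trans ((lintegral_mono fun t => hg _).trans ?_)
  rw [setLIntegral_const, Real.volume_Icc, sub_zero, edist_dist]

/-- Bounded approximation from below of `ρ` by an inf-convolution. -/
def infConv (ρ : X → ℝ≥0∞) (n : ℕ) (x : X) : ℝ≥0∞ :=
  ⨅ y, (min (ρ y) n + n * edist x y)

lemma infConv_le_min (ρ : X → ℝ≥0∞) (n : ℕ) (x : X) : infConv ρ n x ≤ min (ρ x) n :=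
  iInf_le_of_le x (by simp)

lemma le_infConv {ρ : X → ℝ≥0∞} {c : ℝ≥0∞} (hc : ∀ x, c ≤ ρ x) {n : ℕ} (hn : c ≤ n) (x : X) :
    c ≤ infConv ρ n x :=
  le_iInf fun y => (le_min (hc y) hn).trans le_self_add

lemma measurable_infConv [MeasurableSpace X] [BorelSpace X] (ρ : X → ℝ≥0∞) (n : ℕ) :
    Measurable (infConv ρ n) := by
  refine UpperSemicontinuous.measurable (upperSemicontinuous_iInf fun y => ?_)
  refine Continuous.upperSemicontinuous (continuous_const.add ?_)
  exact (ENNReal.continuous_const_mul (natCast_ne_top n)).comp (continuous_id.edist continuous_const)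

lemma le_liminf_infConv {ρ : X → ℝ≥0∞} (hρ : LowerSemicontinuous ρ) {φ : ℕ → ℕ}
    (hφ : Tendsto φ atTop atTop) {z : ℕ → X} {x : X} (hz : Tendsto z atTop (nhds x)) :
    ρ x ≤ liminf (fun n => infConv ρ (φ n) (z n)) atTop := by
  refine le_of_forall_lt fun a ha => ?_
  obtain ⟨b, hab, hb⟩ := exists_between ha
  refine hab.trans_le (le_liminf_of_le (by isBoundedDefault) ?_)
  lift b to NNReal using hb.ne_top
  obtain ⟨δ, hδ, hball⟩ := Metric.eventually_nhds_iff.1 (hρ x b hb)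
  filter_upwards [hz.eventually (ball_mem_nhds x (half_pos hδ)),
    hφ.eventually (eventually_ge_atTop ⌈(b : ℝ) + b / (δ / 2)⌉₊)] with n hn1 hn2
  have hn3 : (b : ℝ) + b / (δ / 2) ≤ φ n := (Nat.le_ceil _).trans (by exact_mod_cast hn2)
  have hn4 : (b : ℝ) ≤ φ n := le_trans (by simp; positivity) hn3
  have hn5 : (b : ℝ) / (δ / 2) ≤ φ n := le_trans (by simp) hn3
  refine le_iInf fun y => ?_
  by_cases hy : dist y x < δ
  · refine le_trans (le_min (hball hy).le ?_) le_self_add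
    exact_mod_cast hn4
  · have h1 : δ / 2 ≤ dist (z n) y := by
      rw [dist_comm] at hn1
      rw [dist_comm] at hy
      linarith [dist_triangle x (z n) y]
    refine le_trans ?_ le_add_self
    rw [edist_dist, ← ENNReal.ofReal_natCast, ← ENNReal.ofReal_mul (by positivity),
      ← ENNReal.ofReal_coe_nnreal]
    refine ofReal_le_ofReal ?_
    rw [div_le_iff₀ (half_pos hδ)] at hn5
    exact hn5.trans (by gcongr)

/-- The Arzelà–Ascoli theorem for `1`-Lipschitz paths starting in a compact set. -/
lemma isCompact_setOf_lipschitzWith_one [ProperSpace X] {E : Set X} (hE : IsCompact E) :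
    IsCompact {f : C(ℝ, X) | LipschitzWith 1 f ∧ f 0 ∈ E} := by
  refine ArzelaAscoli.isCompact_of_equicontinuous _ ?_ ?_
  · have himg : ContinuousMap.toFun '' {f : C(ℝ, X) | LipschitzWith 1 f ∧ f 0 ∈ E} =
        {f : ℝ → X | LipschitzWith 1 f} ∩ {f | f 0 ∈ E} := by
      ext f
      constructor
      · rintro ⟨f, hf, rfl⟩
        exact hf
      · rintro ⟨h1, h2⟩
        exact ⟨⟨f, h1.continuous⟩, ⟨h1, h2⟩, rfl⟩
    rw [himg]
    rcases E.eq_empty_or_nonempty with rfl | ⟨e, he⟩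
    · simp
    obtain ⟨R, hR⟩ := hE.isBounded.subset_closedBall e
    refine (isCompact_univ_pi (X := fun _ : ℝ => X) (s := fun t => closedBall e (|t| + R))
      fun t => isCompact_closedBall _ _).of_isClosed_subset
      ((isClosed_setOfPred_lipschitzWith 1).inter
        (hE.isClosed.preimage (continuous_apply (0 : ℝ)))) ?_
    rintro f ⟨h1, h2⟩ t -
    have h3 := LipschitzWith.dist_le_mul h1 t 0
    have h4 := hR h2
    rw [mem_closedBall] at h4 ⊢
    simp only [NNReal.coe_one, one_mul, Real.dist_eq, sub_zero] at h3
    exact (dist_triangle _ _ _).trans (add_le_add h3 h4)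
  · exact LipschitzWith.uniformEquicontinuous _ 1 (fun f => f.2.1) |>.equicontinuous

/-- If every `1`-Lipschitz path from the compact set `E` to the closed set `F` has cost at least
`1` for the lower semicontinuous density `ρ`, then for a suitable inf-convolution of `ρ` all the
costs are at least `1 / 2`. -/
lemma exists_half_le_pathCost [ProperSpace X] {E F : Set X} (hE : IsCompact E) (hF : IsClosed F)
    {ρ : X → ℝ≥0∞} (hρ : LowerSemicontinuous ρ) {c : ℝ} (hc : 0 < c) (hc1 : c ≤ 1)
    (hcρ : ∀ x, ENNReal.ofReal c ≤ ρ x)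
    (hadm : ∀ f : ℝ → X, LipschitzWith 1 f → ∀ L : ℝ, 0 ≤ L → f 0 ∈ E → f L ∈ F →
      1 ≤ ∫⁻ t in Icc 0 L, ρ (f t)) :
    ∃ n : ℕ, ∀ y ∈ F, 1 / 2 ≤ pathCost (infConv ρ n) E y := by
  by_contra! hcon
  have hex (n : ℕ) : ∃ p : C(ℝ, X) × ℝ, (LipschitzWith 1 p.1 ∧ p.1 0 ∈ E) ∧
      p.2 ∈ Icc 0 (1 / c) ∧ p.1 p.2 ∈ F ∧
      ∫⁻ t in Icc 0 p.2, infConv ρ (n + 1) (p.1 t) ≤ 1 / 2 := by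
    obtain ⟨y, hy, hlt⟩ := hcon (n + 1)
    rw [pathCost, iInf_lt_iff] at hlt
    obtain ⟨⟨⟨f, L⟩, hf, hL, h0, h1⟩, hlt⟩ := hlt
    simp only at hf hL h0 h1 hlt
    refine ⟨(⟨f, hf.continuous⟩, L), ⟨hf, h0⟩, ⟨hL, ?_⟩, by simpa [h1] using hy, hlt.le⟩
    have hc' : ENNReal.ofReal c ≤ ((n + 1 : ℕ) : ℝ≥0∞) := by
      refine (ofReal_le_ofReal hc1).trans ?_
      rw [ofReal_one]
      exact_mod_cast Nat.le_add_left 1 n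
    have h2 : ENNReal.ofReal (c * L) ≤ 1 / 2 := by
      refine le_trans (le_of_eq ?_) ((lintegral_mono fun t =>
        le_infConv hcρ hc' (f t)).trans hlt.le)
      rw [setLIntegral_const, Real.volume_Icc, sub_zero, ofReal_mul hc.le]
    have h3 : ENNReal.ofReal (c * L) ≤ ENNReal.ofReal 1 := by
      rw [ofReal_one]
      exact h2.trans (by simp)
    rw [ofReal_le_ofReal_iff zero_le_one] at h3
    rw [le_div_iff₀ hc]
    linarith
  choose p hp1 hp2 hp3 hp4 using hex
  obtain ⟨⟨f, L⟩, ⟨⟨hf, hf0⟩, hL⟩, φ, hφ, hlim⟩ :=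
    ((isCompact_setOf_lipschitzWith_one hE).prod (isCompact_Icc (a := (0 : ℝ)) (b := 1 / c)))
      |>.tendsto_subseq (x := p) fun n => ⟨hp1 n, hp2 n⟩
  have hlim1 : Tendsto (fun n => (p (φ n)).1) atTop (nhds f) := (continuous_fst.tendsto _).comp hlim
  have hlim2 : Tendsto (fun n => (p (φ n)).2) atTop (nhds L) := (continuous_snd.tendsto _).comp hlim
  have hfL : f L ∈ F := by
    refine hF.mem_of_tendsto (f := fun n => (p (φ n)).1 (p (φ n)).2) (b := atTop) ?_
      (Eventually.of_forall fun n => hp3 _)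
    exact (ContinuousEval.continuous_eval.tendsto (f, L)).comp hlim
  have key : ∫⁻ t in Icc 0 L, ρ (f t) ≤ 1 / 2 := by
    have hφ' : Tendsto (fun n => φ n + 1) atTop atTop :=
      (tendsto_add_atTop_nat 1).comp hφ.tendsto_atTop
    rw [setLIntegral_congr Ico_ae_eq_Icc.symm, ← lintegral_indicator measurableSet_Ico]
    calc ∫⁻ t, (Ico 0 L).indicator (fun t => ρ (f t)) t
        ≤ ∫⁻ t, liminf (fun n => (Icc 0 (p (φ n)).2).indicator
            (fun t => infConv ρ (φ n + 1) ((p (φ n)).1 t)) t) atTop := by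
          refine lintegral_mono fun t => ?_
          by_cases ht : t ∈ Ico 0 L
          · rw [indicator_of_mem ht]
            have h1 : Tendsto (fun n => (p (φ n)).1 t) atTop (nhds (f t)) :=
              ((ContinuousEvalConst.continuous_eval_const t).tendsto f).comp hlim1
            refine (le_liminf_infConv hρ hφ' h1).trans (liminf_le_liminf ?_)
            filter_upwards [hlim2.eventually (lt_mem_nhds ht.2)] with n hn
            rw [indicator_of_mem (show t ∈ Icc 0 _ from ⟨ht.1, hn.le⟩)]
          · rw [indicator_of_notMem ht]
            exact zero_le
      _ ≤ liminf (fun n => ∫⁻ t, (Icc 0 (p (φ n)).2).indicator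
            (fun t => infConv ρ (φ n + 1) ((p (φ n)).1 t)) t) atTop := by
          borelize X
          exact lintegral_liminf_le fun n => ((measurable_infConv ρ _).comp
            (p (φ n)).1.continuous.measurable).indicator measurableSet_Icc
      _ ≤ 1 / 2 := by
          refine liminf_le_of_le (by isBoundedDefault) fun b hb => ?_
          obtain ⟨n, hn⟩ := hb.exists
          rw [lintegral_indicator measurableSet_Icc] at hn
          exact hn.trans (hp4 _)
  have := (hadm f hf L hL.1 hf0 hfL).trans key
  norm_num at this

lemma tendsto_average_ball [MeasurableSpace X] [OpensMeasurableSpace X] {μ : Measure X}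
    {u : X → ℝ} (hu : Continuous u) {x : X} {r : ℕ → ℝ} (hr : Tendsto r atTop (nhds 0))
    (h0 : ∀ k, μ (ball x (r k)) ≠ 0) (hfin : ∀ k, μ (ball x (r k)) ≠ ⊤)
    (hint : ∀ k, IntegrableOn u (ball x (r k)) μ) :
    Tendsto (fun k => ⨍ z in ball x (r k), u z ∂μ) atTop (nhds (u x)) := by
  refine Metric.tendsto_nhds.2 fun ε hε => ?_
  obtain ⟨δ, hδ, H⟩ := Metric.continuous_iff.1 hu x (ε / 2) (half_pos hε)
  filter_upwards [hr.eventually (gt_mem_nhds hδ)] with k hk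
  have : Fact (μ (ball x (r k)) < ⊤) := ⟨(hfin k).lt_top⟩
  have : NeZero (μ.restrict (ball x (r k))) := ⟨by simpa using h0 k⟩
  have h1 := ofReal_abs_sub_average_le (hint k) (u x)
  have h2 : (∫⁻ z in ball x (r k), ENNReal.ofReal |u x - u z| ∂μ) ≤
      ENNReal.ofReal (ε / 2) * μ (ball x (r k)) := by
    rw [← setLIntegral_const]
    refine setLIntegral_mono' measurableSet_ball fun z hz => ofReal_le_ofReal ?_
    have := H z (lt_trans hz hk)
    rw [Real.dist_eq, abs_sub_comm] at this
    exact this.le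
  rw [Measure.restrict_apply_univ] at h1
  have h3 := h1.trans (ENNReal.div_le_of_le_mul h2)
  rw [ofReal_le_ofReal_iff (by positivity), abs_sub_comm, ← Real.dist_eq] at h3
  linarith

/-- A covering argument: if a measure is large on small balls centred on a set whose image under
`dist e` contains an interval, then it is large. -/
lemma ofReal_mul_le_of_forall_exists_ball [TopologicalSpace.SeparableSpace X] [MeasurableSpace X]
    [OpensMeasurableSpace X] (ν : Measure X) {A U : Set X} {e : X} {ℓ R η : ℝ} (hη : 0 ≤ η)
    (hA : Icc 0 ℓ ⊆ dist e '' A)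
    (h : ∀ x ∈ A, ∃ s, 0 < s ∧ s ≤ R ∧ ball x (3 * s) ⊆ U ∧
      ENNReal.ofReal (η * s) ≤ ν (ball x (3 * s))) :
    ENNReal.ofReal (η * ℓ) ≤ 30 * ν U := by
  choose! s hs0 hsR hsU hsν using h
  obtain ⟨T, hTA, hdisj, hcov⟩ := Vitali.exists_disjoint_subfamily_covering_enlargement_closedBall
    A id (fun x => 3 * s x) (3 * R) (fun x hx => by linarith [hsR x hx]) 5 (by norm_num)
  simp only [id] at hdisj hcov
  have hcount : T.Countable := hdisj.countable_of_nonempty_interior fun x hx =>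
    ⟨x, ball_subset_interior_closedBall (mem_ball_self (by linarith [hs0 x (hTA hx)]))⟩
  have hvol : ENNReal.ofReal ℓ ≤ ∑' x : T, ENNReal.ofReal (30 * s x) := by
    calc ENNReal.ofReal ℓ = volume (Icc 0 ℓ) := by simp
      _ ≤ volume (⋃ x ∈ T, closedBall (dist e x) (15 * s x)) := by
        refine measure_mono fun t ht => ?_
        obtain ⟨y, hy, rfl⟩ := hA ht
        obtain ⟨x, hx, hxy⟩ := hcov y hy
        refine mem_biUnion hx ?_
        have h1 := hxy (mem_closedBall_self (by linarith [hs0 y hy]))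
        rw [mem_closedBall] at h1 ⊢
        rw [dist_comm e y, dist_comm e x]
        refine (abs_dist_sub_le y x e).trans (h1.trans (by linarith))
      _ ≤ ∑' x : T, volume (closedBall (dist e x) (15 * s x)) := measure_biUnion_le _ hcount _
      _ = _ := by
        refine tsum_congr fun x => ?_
        rw [Real.volume_closedBall]
        ring_nf
  calc ENNReal.ofReal (η * ℓ) = ENNReal.ofReal η * ENNReal.ofReal ℓ := ofReal_mul hη
    _ ≤ ENNReal.ofReal η * ∑' x : T, ENNReal.ofReal (30 * s x) := by gcongr
    _ = ∑' x : T, 30 * ENNReal.ofReal (η * s x) := by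
      rw [← ENNReal.tsum_mul_left]
      refine tsum_congr fun x => ?_
      rw [← ofReal_mul hη, mul_left_comm, ofReal_mul (by norm_num), ofReal_ofNat]
    _ ≤ ∑' x : T, 30 * ν (ball (x : X) (3 * s x)) := by
      gcongr with x
      exact hsν x (hTA x.2)
    _ = 30 * ν (⋃ x ∈ T, ball x (3 * s x)) := by
      rw [ENNReal.tsum_mul_left, measure_biUnion hcount
        (hdisj.mono fun x => ball_subset_closedBall) fun x _ => measurableSet_ball]
    _ ≤ 30 * ν U := by
      gcongr
      exact iUnion₂_subset fun x hx => hsU x (hTA hx)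

namespace IsCarnotGroup

variable {G : Type*} [Group G] [MetricSpace G] [MeasurableSpace G] {μ : Measure G} {Q : ℝ}
  [BorelSpace G] [IsLocallyFiniteMeasure μ] [TopologicalSpace.SeparableSpace G]

/-- Means over comparable balls differ little when the `Q`-energy is small. -/
lemma exists_abs_average_sub_average_le (hG : IsCarnotGroup G μ Q) :
    ∃ K : ℝ, 0 < K ∧ ∀ u : G → ℝ, Continuous u → ∀ g : G → ℝ≥0∞, Measurable g →
      IsPathGradient g u → ∀ (x y : G) (r s b : ℝ), 0 < s → r ≤ 2 * s → ball y s ⊆ ball x r →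
      0 ≤ b → ∫⁻ z in ball x (3 * r), g z ^ Q ∂μ ≤ ENNReal.ofReal (b ^ Q) →
      |(⨍ z in ball y s, u z ∂μ) - ⨍ z in ball x r, u z ∂μ| ≤ K * b := by
  obtain ⟨K, hK, H⟩ := hG.exists_poincare
  obtain ⟨V, hV, hball⟩ := hG.exists_measure_ball_eq
  have := hG.properSpace
  have hQ := hG.dim_pos
  refine ⟨2 ^ Q * (K / (3 * V ^ (1 / Q))), by positivity,
    fun u hu g hg hug x y r s b hs hrs hsub hb hE => ?_⟩
  have hr : 0 < r := dist_nonneg.trans_lt (hsub (mem_ball_self hs))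
  have hosc : (∫⁻ z in ball x r, ENNReal.ofReal |u z - ⨍ w in ball x r, u w ∂μ| ∂μ) ≤
      ENNReal.ofReal (K / (3 * V ^ (1 / Q)) * b * (V * r ^ Q)) := by
    have h1 := H x r hr u hu.measurable g hg hug
    have h3V : 0 < V * (3 * r) ^ Q := by positivity
    have h2 : (∫⁻ z in ball x (3 * r), g z ∂μ) / μ (ball x (3 * r)) ≤
        ENNReal.ofReal (b / (V ^ (1 / Q) * (3 * r))) := by
      refine (setLIntegral_div_le_rpow (by rw [hball x _ (by positivity)]; simpa using h3V)
        (by rw [hball x _ (by positivity)]; exact ofReal_ne_top) hG.one_le_dim hg).trans ?_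
      rw [hball x _ (by positivity)]
      calc _ ≤ (ENNReal.ofReal (b ^ Q) / ENNReal.ofReal (V * (3 * r) ^ Q)) ^ (1 / Q) := by gcongr
        _ = _ := by
          rw [← ofReal_div_of_pos h3V, ofReal_rpow_of_nonneg (by positivity) (by positivity),
            Real.div_rpow (by positivity) (by positivity),
            Real.mul_rpow (by positivity) (by positivity), one_div,
            Real.rpow_rpow_inv hb hQ.ne', Real.rpow_rpow_inv (by positivity) hQ.ne']
    rw [hball x r hr] at h1
    have h0 : 0 < V * r ^ Q := by positivity
    rw [ENNReal.div_le_iff (by simpa using h0) ofReal_ne_top] at h1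
    refine h1.trans ?_
    rw [ofReal_mul (p := K / (3 * V ^ (1 / Q)) * b) (by positivity)]
    gcongr
    calc _ ≤ ENNReal.ofReal (K * r) * ENNReal.ofReal (b / (V ^ (1 / Q) * (3 * r))) := by gcongr
      _ = _ := by
        rw [← ofReal_mul (by positivity)]
        congr 1
        field_simp
  have hint : IntegrableOn u (ball y s) μ :=
    (hu.continuousOn.integrableOn_compact (isCompact_closedBall y s)).mono_set ball_subset_closedBall
  have hys : 0 < V * s ^ Q := by positivity
  have : Fact (μ (ball y s) < ⊤) := ⟨by rw [hball y s hs]; exact ofReal_lt_top⟩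
  have : NeZero (μ.restrict (ball y s)) := ⟨by
    rw [Ne, Measure.restrict_eq_zero, hball y s hs]; simpa using hys⟩
  set m := ⨍ z in ball x r, u z ∂μ
  have h1 := ofReal_abs_sub_average_le hint m
  rw [Measure.restrict_apply_univ, hball y s hs] at h1
  rw [abs_sub_comm, ← ofReal_le_ofReal_iff (by positivity)]
  refine h1.trans (ENNReal.div_le_of_le_mul ?_)
  simp only [abs_sub_comm m]
  refine (lintegral_mono_set hsub).trans (hosc.trans ?_)
  rw [← ofReal_mul (by positivity)]
  refine ofReal_le_ofReal ?_
  have h2 : r ^ Q ≤ 2 ^ Q * s ^ Q := by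
    rw [← Real.mul_rpow (by positivity) (by positivity)]
    gcongr
  calc _ ≤ K / (3 * V ^ (1 / Q)) * b * (V * (2 ^ Q * s ^ Q)) := by gcongr
    _ = _ := by ring

/-- Pointwise estimate by telescoping, at points around which the `Q`-energy decays
geometrically. -/
lemma abs_sub_average_le (hG : IsCarnotGroup G μ Q) {K : ℝ} {u : G → ℝ} (hu : Continuous u)
    {g : G → ℝ≥0∞}
    (hK : ∀ (x y : G) (r s b : ℝ), 0 < s → r ≤ 2 * s → ball y s ⊆ ball x r →
      0 ≤ b → ∫⁻ z in ball x (3 * r), g z ^ Q ∂μ ≤ ENNReal.ofReal (b ^ Q) →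
      |(⨍ z in ball y s, u z ∂μ) - ⨍ z in ball x r, u z ∂μ| ≤ K * b)
    {x : G} {R a θ : ℝ} (hR : 0 < R) (ha : 0 ≤ a) (hθ : 0 ≤ θ) (hθ1 : θ < 1)
    (h : ∀ k : ℕ, ∫⁻ z in ball x (3 * (R / 2 ^ k)), g z ^ Q ∂μ ≤
      ENNReal.ofReal ((a * θ ^ k) ^ Q)) :
    |u x - ⨍ z in ball x R, u z ∂μ| ≤ K * a / (1 - θ) := by
  obtain ⟨V, hV, hball⟩ := hG.exists_measure_ball_eq
  have := hG.properSpace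
  have hpos (k : ℕ) : 0 < R / 2 ^ k := by positivity
  have hlim : Tendsto (fun k : ℕ => ⨍ z in ball x (R / 2 ^ k), u z ∂μ) atTop (nhds (u x)) := by
    refine tendsto_average_ball hu ?_ (fun k => ?_) (fun k => ?_) fun k =>
      (hu.continuousOn.integrableOn_compact (isCompact_closedBall x _)).mono_set
        ball_subset_closedBall
    · exact tendsto_const_nhds.div_atTop (tendsto_pow_atTop_atTop_of_one_lt one_lt_two)
    · have : 0 < V * (R / 2 ^ k) ^ Q := by positivity
      rw [hball x _ (hpos k)]
      simpa using this
    · rw [hball x _ (hpos k)]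
      exact ofReal_ne_top
  have := dist_le_of_le_geometric_of_tendsto₀ θ (K * a) hθ1 (fun k => ?_) hlim
  · rw [pow_zero, div_one, dist_comm, Real.dist_eq] at this
    exact this
  · rw [dist_comm, Real.dist_eq, mul_assoc]
    have h2 : R / 2 ^ k = 2 * (R / 2 ^ (k + 1)) := by rw [pow_succ]; field_simp
    refine hK x x _ _ _ (hpos _) h2.le (ball_subset_ball ?_) (by positivity) (h k)
    linarith [hpos (k + 1)]

end IsCarnotGroup

namespace IsCarnotGroup

variable {G : Type*} [Group G] [MetricSpace G] [MeasurableSpace G] {μ : Measure G} {Q : ℝ}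
  [BorelSpace G] [IsLocallyFiniteMeasure μ] [TopologicalSpace.SeparableSpace G]

/-- A function separating two sets that are large when seen from one of their points has large
`Q`-energy. -/
lemma exists_energy_lower_bound (hG : IsCarnotGroup G μ Q) :
    ∃ κ : ℝ, 0 < κ ∧ ∀ u : G → ℝ, Continuous u → ∀ g : G → ℝ≥0∞, Measurable g →
      IsPathGradient g u → ∀ (E F : Set G) (e f : G) (ℓ R : ℝ), 0 < ℓ → dist e f + 2 * ℓ ≤ R →
      Icc 0 ℓ ⊆ dist e '' (E ∩ closedBall e ℓ) → Icc 0 ℓ ⊆ dist f '' (F ∩ closedBall f ℓ) →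
      (∀ x ∈ E, u x = 0) → (∀ y ∈ F, 1 / 2 ≤ u y) →
      ENNReal.ofReal (κ * (ℓ / R)) ≤ ∫⁻ z in ball e (7 * R), g z ^ Q ∂μ := by
  obtain ⟨K, hK, H⟩ := hG.exists_abs_average_sub_average_le
  have hQ := hG.dim_pos
  set θ : ℝ := (1 / 2) ^ (1 / Q) with hθ_def
  have hθ : 0 < θ := by positivity
  have hθ1 : θ < 1 := Real.rpow_lt_one (by norm_num) (by norm_num) (by positivity)
  have hθQ : θ ^ Q = 1 / 2 := by
    rw [hθ_def, one_div Q, Real.rpow_inv_rpow (by norm_num) hQ.ne']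
  set a : ℝ := (1 - θ) / (16 * K) with ha_def
  have ha : 0 < a := div_pos (by linarith) (by positivity)
  refine ⟨a ^ Q / 30, by positivity, fun u hu g hg hug E F e f ℓ R hℓ hR hE hF huE huF => ?_⟩
  have hef : 0 ≤ dist e f := dist_nonneg
  have hR0 : 0 < R := by linarith
  by_contra! hlt
  set ν := μ.withDensity fun z => g z ^ Q
  have hν (z : G) (s : ℝ) : ν (ball z s) = ∫⁻ w in ball z s, g w ^ Q ∂μ :=
    withDensity_apply _ measurableSet_ball
  have hpow (k : ℕ) : (a * θ ^ k) ^ Q = a ^ Q / R * (R / 2 ^ k) := by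
    rw [Real.mul_rpow ha.le (by positivity), ← Real.rpow_natCast_mul hθ.le, mul_comm (k : ℝ),
      Real.rpow_mul_natCast hθ.le, hθQ]
    field_simp
    simp
  have hgood (A : Set G) (c : G) (hA : Icc 0 ℓ ⊆ dist c '' (A ∩ closedBall c ℓ))
      (hc : dist e c + ℓ + 3 * R ≤ 7 * R) : ∃ x ∈ A ∩ closedBall c ℓ, ∀ k : ℕ,
      ∫⁻ z in ball x (3 * (R / 2 ^ k)), g z ^ Q ∂μ ≤ ENNReal.ofReal ((a * θ ^ k) ^ Q) := by
    by_contra! hbad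
    have := ofReal_mul_le_of_forall_exists_ball ν (U := ball e (7 * R)) (R := R) (η := a ^ Q / R)
      (by positivity) hA fun x hx => ?_
    · rw [hν] at this
      refine absurd (this.trans_lt (ENNReal.mul_lt_mul_right (by norm_num) (by norm_num) hlt)) ?_
      rw [← ofReal_ofNat, ← ofReal_mul (by norm_num), not_lt]
      refine ofReal_le_ofReal (le_of_eq ?_)
      ring
    · obtain ⟨k, hk⟩ := hbad x hx
      have hkR : R / 2 ^ k ≤ R := div_le_self hR0.le (one_le_pow₀ one_le_two)
      refine ⟨R / 2 ^ k, by positivity, hkR, ball_subset_ball' ?_, ?_⟩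
      · have h1 : dist x c ≤ ℓ := hx.2
        have h2 := dist_triangle x c e
        rw [dist_comm c e] at h2
        linarith
      · rw [hν, ← hpow]
        exact hk.le
  obtain ⟨x, ⟨hxE, hxe⟩, hx⟩ := hgood E e hE (by rw [dist_self]; linarith)
  obtain ⟨y, ⟨hyF, hyf⟩, hy⟩ := hgood F f hF (by linarith)
  rw [mem_closedBall] at hxe hyf
  have hKa : K * a / (1 - θ) = 1 / 16 := by
    have : 1 - θ ≠ 0 := by linarith
    rw [ha_def]; field_simp
  have hKa' : K * a ≤ 1 / 16 := by
    rw [← hKa, le_div_iff₀ (by linarith)]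
    nlinarith [mul_pos hK ha]
  have h1 := hG.abs_sub_average_le hu (H u hu g hg hug) hR0 ha.le hθ.le hθ1 hx
  have h2 := hG.abs_sub_average_le hu (H u hu g hg hug) hR0 ha.le hθ.le hθ1 hy
  have hbig : ∫⁻ z in ball x (3 * (2 * R)), g z ^ Q ∂μ ≤ ENNReal.ofReal (a ^ Q) := by
    refine (lintegral_mono_set (ball_subset_ball' ?_)).trans (hlt.le.trans (ofReal_le_ofReal ?_))
    · linarith
    · have : ℓ / R ≤ 1 := by rw [div_le_one hR0]; linarith
      have : 0 < ℓ / R := by positivity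
      nlinarith [Real.rpow_pos_of_pos ha Q]
  have h3 := H u hu g hg hug x x (2 * R) R a hR0 le_rfl (ball_subset_ball (by linarith)) ha.le hbig
  have h4 := H u hu g hg hug x y (2 * R) R a hR0 le_rfl (ball_subset_ball' (by
    have := dist_triangle4 y f e x
    rw [dist_comm f e, dist_comm e x] at this
    linarith)) ha.le hbig
  rw [hKa, abs_le] at h1 h2
  rw [abs_le] at h3 h4
  have h5 := huE x hxE
  have h6 := huF y hyF
  linarith

end IsCarnotGroup

/-- The distances from a point `e` of a continuum fill an interval. -/
lemma IsContinuum.Icc_subset_image_dist {E : Set X} (hE : IsContinuum E) {e : X} (he : e ∈ E)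
    {ℓ : ℝ} (hℓ : 0 < ℓ) (hdiam : ENNReal.ofReal (3 * ℓ) ≤ ediam E) :
    Icc 0 ℓ ⊆ dist e '' (E ∩ closedBall e ℓ) := by
  obtain ⟨x, hx, hxℓ⟩ : ∃ x ∈ E, ℓ ≤ dist e x := by
    by_contra! hcon
    have h1 : ediam E ≤ ENNReal.ofReal (2 * ℓ) := by
      refine ediam_le fun x hx y hy => ?_
      rw [edist_dist]
      refine ofReal_le_ofReal ?_
      have := hcon x hx
      have := hcon y hy
      linarith [dist_triangle_left x y e]
    have h2 := hdiam.trans h1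
    rw [ofReal_le_ofReal_iff (by positivity)] at h2
    linarith
  intro t ht
  obtain ⟨y, hy, rfl⟩ := hE.2.isPreconnected.intermediate_value he hx
    (f := dist e) (by fun_prop) (show t ∈ Icc (dist e e) (dist e x) by
      rw [dist_self]; exact ⟨ht.1, ht.2.trans hxℓ⟩)
  exact ⟨y, ⟨hy, by rw [mem_closedBall, dist_comm]; exact ht.2⟩, rfl⟩

/-- Quantitative choice of points on two continua with bounded relative distance. -/
lemma IsContinuum.exists_points {E F : Set X} (hE : IsContinuum E) (hE' : E.Nontrivial)
    (hF : IsContinuum F) (hF' : F.Nontrivial) {t : ℝ} (ht : 0 < t)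
    (h : setEDist E F ≤ ENNReal.ofReal t * min (ediam E) (ediam F)) :
    ∃ e ∈ E, ∃ f ∈ F, ∃ ℓ : ℝ, 0 < ℓ ∧ dist e f ≤ 3 * t * ℓ ∧
      3 * ℓ ≤ diam E ∧
      Icc 0 ℓ ⊆ dist e '' (E ∩ closedBall e ℓ) ∧ Icc 0 ℓ ⊆ dist f '' (F ∩ closedBall f ℓ) := by
  obtain ⟨⟨e, f⟩, ⟨he, hf⟩, hmin⟩ := (hE.1.prod hF.1).exists_isMinOn
    (hE'.nonempty.prod hF'.nonempty) (f := fun p => dist p.1 p.2) (by fun_prop)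
  have hdE : 0 < diam E := diam_pos hE' hE.1.isBounded
  have hdF : 0 < diam F := diam_pos hF' hF.1.isBounded
  have heE : ediam E = ENNReal.ofReal (diam E) :=
    (ofReal_toReal hE.1.isBounded.ediam_ne_top).symm
  have heF : ediam F = ENNReal.ofReal (diam F) :=
    (ofReal_toReal hF.1.isBounded.ediam_ne_top).symm
  set d := min (diam E) (diam F)
  have hd : 0 < d := lt_min hdE hdF
  have h3 : 3 * (d / 3) = d := by ring
  refine ⟨e, he, f, hf, d / 3, by positivity, ?_, ?_, hE.Icc_subset_image_dist he (by positivity) ?_,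
    hF.Icc_subset_image_dist hf (by positivity) ?_⟩
  · have h1 : ENNReal.ofReal (dist e f) ≤ setEDist E F := by
      refine le_iInf₂ fun x hx => ?_
      refine Metric.le_infEDist.2 fun y hy => ?_
      rw [edist_dist]
      exact ofReal_le_ofReal (hmin (show (x, y) ∈ E ×ˢ F from ⟨hx, hy⟩))
    have h2 := h1.trans h
    rw [heE, heF, ← ENNReal.ofReal_min, ← ofReal_mul ht.le,
      ofReal_le_ofReal_iff (by positivity)] at h2
    linarith
  · rw [h3]; exact min_le_left _ _
  · rw [h3, heE]; exact ofReal_le_ofReal (min_le_left _ _)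
  · rw [h3, heF]; exact ofReal_le_ofReal (min_le_right _ _)

/-- A `1`-Lipschitz path that starts in `ball x₀ (r / 2)` and leaves `ball x₀ r` spends time at
least `r / 2` outside the smaller ball. -/
lemma one_le_setLIntegral_of_exit {x₀ : X} {r : ℝ} (hr : 0 < r) {f : ℝ → X}
    (hf : LipschitzWith 1 f) (h0 : f 0 ∈ ball x₀ (r / 2)) {L t : ℝ} (ht : t ∈ Icc 0 L)
    (hexit : r ≤ dist (f t) x₀) {ρ : X → ℝ≥0∞}
    (hρ : ∀ x, r / 2 < dist x x₀ → ENNReal.ofReal (4 / r) ≤ ρ x) :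
    1 ≤ ∫⁻ s in Icc 0 L, ρ (f s) := by
  have hlip (s s' : ℝ) : dist (f s) (f s') ≤ |s - s'| := by
    simpa [Real.dist_eq] using hf.dist_le_mul s s'
  have h1 : r / 2 ≤ t := by
    have h2 := hlip t 0
    rw [sub_zero, abs_of_nonneg ht.1] at h2
    rw [mem_ball] at h0
    linarith [dist_triangle (f t) (f 0) x₀]
  calc (1 : ℝ≥0∞) ≤ ENNReal.ofReal (4 / r * (r / 2)) := by
        rw [show 4 / r * (r / 2) = 2 by field_simp; norm_num, ofReal_ofNat]
        norm_num
    _ = ∫⁻ _ in Ioc (t - r / 2) t, ENNReal.ofReal (4 / r) := by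
        rw [setLIntegral_const, Real.volume_Ioc, ← ofReal_mul (by positivity), _root_.sub_sub_cancel]
    _ ≤ ∫⁻ s in Ioc (t - r / 2) t, ρ (f s) := by
        refine setLIntegral_mono' measurableSet_Ioc fun s hs => hρ _ ?_
        have h2 := hlip t s
        rw [abs_of_nonneg (by linarith [hs.2])] at h2
        linarith [dist_triangle (f t) (f s) x₀, hs.1]
    _ ≤ _ := lintegral_mono_set (Ioc_subset_Icc_self.trans
        (Icc_subset_Icc (by linarith) ht.2))

/-- An admissible density for the curves joining `E` and `F` in a ball can be replaced, at an
arbitrarily small cost, by a lower semicontinuous density which is bounded below and admissible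
for all `1`-Lipschitz paths. -/
lemma exists_lowerSemicontinuous_density [MeasurableSpace X] [BorelSpace X] {μ : Measure X}
    [μ.WeaklyRegular] {Q : ℝ} (hQ : 1 ≤ Q) {x₀ : X} {r : ℝ} (hr : 0 < r)
    (hfin : μ (ball x₀ (r / 2)) ≠ ⊤) {E F : Set X} (hE : E ⊆ ball x₀ (r / 2)) {ρ : X → ℝ≥0∞}
    (hρ : Measurable ρ) (hadm : ∀ γ ∈ joiningCurves E F (ball x₀ r), 1 ≤ γ.lineIntegral ρ)
    {ε : NNReal} (hε : 0 < ε) :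
    ∃ (ρ' : X → ℝ≥0∞) (c : ℝ), LowerSemicontinuous ρ' ∧ 0 < c ∧ c ≤ 1 ∧
      (∀ x, ENNReal.ofReal c ≤ ρ' x) ∧
      (∀ f : ℝ → X, LipschitzWith 1 f → ∀ L : ℝ, 0 ≤ L → f 0 ∈ E → f L ∈ F →
        1 ≤ ∫⁻ t in Icc 0 L, ρ' (f t)) ∧
      ∫⁻ x in ball x₀ (r / 2), ρ' x ^ Q ∂μ ≤ (∫⁻ x, ρ x ^ Q ∂μ) + ε := by
  have hQ0 : 0 < Q := by linarith
  obtain ⟨H, hρH, hH, hHint⟩ := exists_le_lowerSemicontinuous_lintegral_ge μ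
    (fun x => ρ x ^ Q) (hρ.pow_const Q) (ε := (ε / 2 : NNReal))
    (by exact_mod_cast (half_pos hε).ne')
  set m := (μ (ball x₀ (r / 2))).toReal
  have hm : 0 ≤ m := toReal_nonneg
  set c : ℝ := min 1 ((ε / 2 : NNReal) / (m + 1))
  have hc0 : 0 < c := lt_min one_pos (div_pos (half_pos hε) (by positivity))
  have hc1 : c ≤ 1 := min_le_left _ _
  set S : Set X := {x | r / 2 < dist x x₀}
  have hS : IsOpen S := isOpen_lt continuous_const (continuous_id.dist continuous_const)
  set ρ' : X → ℝ≥0∞ := fun x => max (H x ^ (1 / Q))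
    (max (ENNReal.ofReal c) (S.indicator (fun _ => ENNReal.ofReal (4 / r)) x))
  have hρρ' (x : X) : ρ x ≤ ρ' x := by
    refine le_max_of_le_left ?_
    have := ENNReal.rpow_le_rpow (hρH x) (z := 1 / Q) (by positivity)
    rwa [one_div, ENNReal.rpow_rpow_inv hQ0.ne', ← one_div] at this
  refine ⟨ρ', c, ?_, hc0, hc1, fun x => le_max_of_le_right (le_max_left _ _), ?_, ?_⟩
  · refine LowerSemicontinuous.sup ?_ (LowerSemicontinuous.sup lowerSemicontinuous_const
      (hS.lowerSemicontinuous_indicator zero_le))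
    exact ENNReal.continuous_rpow_const.comp_lowerSemicontinuous hH
      (ENNReal.monotone_rpow_of_nonneg (by positivity))
  · intro f hf L hL h0 h1
    by_cases hstay : f '' Icc 0 L ⊆ ball x₀ r
    · let γ : Curve X :=
        ⟨Icc 0 L, nonempty_Icc.2 hL, ordConnected_Icc, f, hf.continuous.continuousOn⟩
      have hγ : γ ∈ joiningCurves E F (ball x₀ r) :=
        ⟨hstay, ⟨0, left_mem_Icc.2 hL, h0⟩, ⟨L, right_mem_Icc.2 hL, h1⟩⟩
      exact (hadm γ hγ).trans ((Curve.lineIntegral_le_lintegral hf rfl ρ).trans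
        (lintegral_mono fun t => hρρ' _))
    · obtain ⟨_, ⟨t, ht, rfl⟩, hexit⟩ := not_subset.1 hstay
      rw [mem_ball, not_lt] at hexit
      refine one_le_setLIntegral_of_exit hr hf (hE h0) ht hexit fun x hx => ?_
      refine le_max_of_le_right (le_max_of_le_right ?_)
      rw [indicator_of_mem (show x ∈ S from hx)]
  · have hle : ∀ x ∈ ball x₀ (r / 2), ρ' x ^ Q ≤ H x + ENNReal.ofReal c := by
      intro x hx
      have hxS : x ∉ S := fun h => lt_asymm (mem_ball.1 hx) h
      simp only [ρ', indicator_of_notMem hxS, max_zero]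
      rw [(ENNReal.monotone_rpow_of_nonneg hQ0.le).map_max, one_div,
        ENNReal.rpow_inv_rpow hQ0.ne']
      refine max_le le_self_add (le_trans ?_ le_add_self)
      rw [ofReal_rpow_of_nonneg hc0.le hQ0.le]
      refine ofReal_le_ofReal ?_
      simpa using Real.rpow_le_rpow_of_exponent_ge hc0 hc1 hQ
    calc _ ≤ ∫⁻ x in ball x₀ (r / 2), (H x + ENNReal.ofReal c) ∂μ :=
          setLIntegral_mono' measurableSet_ball hle
      _ = (∫⁻ x in ball x₀ (r / 2), H x ∂μ) + ENNReal.ofReal c * μ (ball x₀ (r / 2)) := by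
          rw [lintegral_add_right _ measurable_const, setLIntegral_const]
      _ ≤ ((∫⁻ x, ρ x ^ Q ∂μ) + (ε / 2 : NNReal)) + (ε / 2 : NNReal) := by
          refine add_le_add ((setLIntegral_le_lintegral _ _).trans hHint) ?_
          rw [← ofReal_toReal hfin, ← ofReal_mul hc0.le, ← ofReal_coe_nnreal]
          refine ofReal_le_ofReal ?_
          have h1 : c * (m + 1) ≤ (ε / 2 : NNReal) := by
            rw [← le_div_iff₀ (by positivity)]
            exact min_le_right _ _
          exact le_trans (by gcongr; linarith) h1
      _ = _ := by rw [add_assoc, ← ENNReal.coe_add, add_halves]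

namespace IsCarnotGroup

variable {G : Type*} [Group G] [MetricSpace G] [MeasurableSpace G] {μ : Measure G} {Q : ℝ}
  [BorelSpace G] [IsLocallyFiniteMeasure μ] [TopologicalSpace.SeparableSpace G]

/-- The Loewner estimate for curves that stay in a ball. -/
lemma exists_le_modulus (hG : IsCarnotGroup G μ Q) :
    ∃ κ : ℝ, 0 < κ ∧ ∀ (x₀ : G) (r : ℝ), 0 < r → ∀ E F : Set G, IsContinuum E → E.Nontrivial →
      IsContinuum F → F.Nontrivial → E ⊆ ball x₀ (1 / 100 * r) → F ⊆ ball x₀ (1 / 100 * r) →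
      ∀ t : ℝ, 0 < t →
        setEDist E F ≤ ENNReal.ofReal t * min (ediam E) (ediam F) →
        ENNReal.ofReal (κ / (1 + t)) ≤ modulus μ Q (joiningCurves E F (ball x₀ r)) := by
  obtain ⟨V, hV, hball⟩ := hG.exists_measure_ball_eq
  obtain ⟨κ, hκ, H⟩ := hG.exists_energy_lower_bound
  have hproper := hG.properSpace
  have hX := hG.hasGeodesics
  refine ⟨κ / 3, by positivity, fun x₀ r hr E F hE hE' hF hF' hEB hFB t ht hdist => ?_⟩
  refine le_iInf fun ρ => le_iInf fun hρ => le_iInf fun hadm => ?_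
  refine ENNReal.le_of_forall_pos_le_add fun ε hε _ => ?_
  have hsub : ball x₀ (1 / 100 * r) ⊆ ball x₀ (r / 2) := ball_subset_ball (by linarith)
  obtain ⟨ρ', c, hlsc, hc0, hc1, hcρ', hadm', hint⟩ := exists_lowerSemicontinuous_density
    hG.one_le_dim hr (by rw [hball _ _ (half_pos hr)]; exact ofReal_ne_top) (hEB.trans hsub) hρ
    hadm hε
  obtain ⟨n, hn⟩ := exists_half_le_pathCost hE.1 hF.1.isClosed hlsc hc0 hc1 hcρ' hadm'
  obtain ⟨e, he, f, hf, ℓ, hℓ, hef, hℓE, hEℓ, hFℓ⟩ := hE.exists_points hE' hF hF' ht hdist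
  have hgn (x : G) : infConv ρ' n x ≤ (n : NNReal) := by
    simpa using (infConv_le_min ρ' n x).trans (min_le_right _ _)
  have hgrad := isPathGradient_pathCost hX hgn hE'.nonempty
  have hdE : diam E ≤ 2 * (1 / 100 * r) :=
    (diam_mono hEB isBounded_ball).trans (diam_ball (by positivity))
  have hex := mem_ball.1 (hEB he)
  have hfx := mem_ball.1 (hFB hf)
  have hefr := dist_triangle_right e f x₀
  set R := dist e f + 2 * ℓ
  have hRt : R ≤ 3 * ℓ * (1 + t) := by nlinarith
  have hR0 : 0 < R := by
    have := dist_nonneg (x := e) (y := f)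
    positivity
  have key := H _ (hgrad.lipschitzWith hX hgn).continuous _ (measurable_infConv ρ' n) hgrad E F e f
    ℓ R hℓ le_rfl hEℓ hFℓ (fun x hx => by rw [pathCost_eq_zero _ hx, toReal_zero]) fun y hy => by
      have := toReal_mono (pathCost_ne_top hX hgn hE'.nonempty y) (hn y hy)
      simpa using this
  calc ENNReal.ofReal (κ / 3 / (1 + t)) ≤ ENNReal.ofReal (κ * (ℓ / R)) := by
        refine ofReal_le_ofReal ?_
        rw [div_div, mul_div_assoc', div_le_div_iff₀ (by positivity) hR0]
        nlinarith
    _ ≤ ∫⁻ z in ball e (7 * R), infConv ρ' n z ^ Q ∂μ := key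
    _ ≤ ∫⁻ z in ball x₀ (r / 2), infConv ρ' n z ^ Q ∂μ :=
        lintegral_mono_set (ball_subset_ball' (by simp only [R]; linarith))
    _ ≤ ∫⁻ z in ball x₀ (r / 2), ρ' z ^ Q ∂μ := lintegral_mono fun z =>
        ENNReal.rpow_le_rpow ((infConv_le_min ρ' n z).trans (min_le_left _ _)) hG.dim_pos.le
    _ ≤ _ := hint

lemma locBoundedGeom (hG : IsCarnotGroup G μ Q) : LocBoundedGeom Q G μ := by
  obtain ⟨V, hV, hball⟩ := hG.exists_measure_ball_eq
  obtain ⟨κ, hκ, H⟩ := hG.exists_le_modulus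
  have := hG.properSpace
  have := hG.simplyConnected
  refine ⟨inferInstance, inferInstance, inferInstance, max 1 V, 1 / 100,
    fun t => ENNReal.ofReal (κ / (1 + t)), le_max_left _ _, by norm_num, by norm_num,
    fun s t hs hst => ?_, fun t ht => ⟨?_, ofReal_lt_top⟩, fun x₀ => ⟨ball x₀ 1,
    ball_mem_nhds x₀ one_pos, isBounded_ball.isCompact_closure, fun r hr _ => ?_,
    fun r hr _ E F hE hE' hF hF' _ hEB hFB t ht hdist =>
      H x₀ r hr E F hE hE' hF hF' hEB hFB t ht hdist⟩⟩
  · have : 0 < 1 + s := by linarith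
    exact ofReal_le_ofReal (by gcongr)
  · rw [ofReal_pos]; positivity
  · rw [hball x₀ r hr]
    refine ofReal_le_ofReal ?_
    gcongr
    exact le_max_right _ _

lemma isLoewner (hG : IsCarnotGroup G μ Q) : IsLoewner Q G μ := by
  obtain ⟨κ, hκ, H⟩ := hG.exists_le_modulus
  refine ⟨fun t => ENNReal.ofReal (κ / (1 + t)), fun s t hs hst => ?_,
    fun t ht => ⟨?_, ofReal_lt_top⟩, fun E F hE hE' hF hF' _ t ht hdist => ?_⟩
  · have : 0 < 1 + s := by linarith
    exact ofReal_le_ofReal (by gcongr)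
  · rw [ofReal_pos]; positivity
  · obtain ⟨r, hr, hsub⟩ := (hE.1.union hF.1).isBounded.subset_ball_lt 0 (1 : G)
    have hr' : r = 1 / 100 * (100 * r) := by ring
    rw [hr'] at hsub
    refine (H 1 (100 * r) (by positivity) E F hE hE' hF hF' (subset_union_left.trans hsub)
      (subset_union_right.trans hsub) t ht hdist).trans ?_
    refine le_iInf fun ρ => le_iInf fun hρ => le_iInf fun hadm => ?_
    exact iInf_le_of_le ρ (iInf_le_of_le hρ (iInf_le_of_le
      (fun γ hγ => hadm γ ⟨subset_univ _, hγ.2⟩) le_rfl))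

end IsCarnotGroup

/-- every Carnot group with its sub-Riemannian (Carnot–Carathéodory) metric and
Haar measure supports a `1`-Poincaré inequality; consequently it supports a `Q`-Poincaré
inequality, is of locally `Q`-bounded geometry, and is `Q`-Loewner, where `Q` is its
homogeneous (Hausdorff) dimension. -/
theorem carnotGroup_poincare_boundedGeom_loewner
    (G : Type*) [Group G] [MetricSpace G] [TopologicalSpace.SeparableSpace G]
    [MeasurableSpace G] [BorelSpace G]
    (μ : Measure G) [IsLocallyFiniteMeasure μ] (Q : ℝ)
    (hG : IsCarnotGroup G μ Q) :
    SupportsPoincare 1 μ ∧ SupportsPoincare Q μ ∧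
      LocBoundedGeom Q G μ ∧ IsLoewner Q G μ := by
  exact ⟨hG.supportsPoincare le_rfl, hG.supportsPoincare hG.one_le_dim, hG.locBoundedGeom,
    hG.isLoewner⟩
end
end

section
/- Every connected metric n-manifold with n ≥ 2 satisfies separation axiom S: for each compact subset F there is a constant λ > 0 such that whenever a finite union A ⊂ F of pairwise disjoint continua, each of diameter less than λ, separates two points x₁, x₂, some single component of A separates x₁ and x₂. -/
open MeasureTheory Metric Set ENNReal Filter

noncomputable section

variable {X Y : Type*} [MetricSpace X] [MetricSpace Y]

/-- `A` separates the points `x₁` and `x₂`: both lie in the complement of `A` but in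
different connected components of it. -/
def SeparatesPts {X : Type*} [MetricSpace X] (A : Set X) (x₁ x₂ : X) : Prop :=
  x₁ ∈ Aᶜ ∧ x₂ ∈ Aᶜ ∧ x₂ ∉ connectedComponentIn Aᶜ x₁

/-- Separation axiom S: for each compact set `F` there is `λ > 0` such that whenever a finite
union `A ⊆ F` of pairwise disjoint continua of diameters less than `λ` separates two points,
a single connected component of `A` separates them. -/
def AxiomS (X : Type*) [MetricSpace X] : Prop :=
  ∀ F : Set X, IsCompact F → ∃ lam : ℝ, 0 < lam ∧
    ∀ (s : Finset (Set X)) (A : Set X), A = ⋃ K ∈ s, K → A ⊆ F →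
      (∀ K ∈ s, IsContinuum K ∧ EMetric.diam K < ENNReal.ofReal lam) →
      ((s : Set (Set X)).Pairwise Disjoint) →
      ∀ x₁ x₂ : X, SeparatesPts A x₁ x₂ →
        ∃ K : Set X, (∃ a ∈ A, K = connectedComponentIn A a) ∧ SeparatesPts K x₁ x₂

/-- The space `E` is unicoherent, for open sets: two connected open sets covering `E` meet in a
connected set. The proof lifts a circle-valued map to `ℝ`. -/
theorem isPreconnected_inter_of_union_eq_univ {E : Type*} [TopologicalSpace E] [NormalSpace E]
    [SimplyConnectedSpace E] [LocallyPathConnectedSpace E] {U W : Set E}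
    (hU : IsOpen U) (hW : IsOpen W) (hUc : IsPreconnected U) (hWc : IsPreconnected W)
    (hUW : U ∪ W = univ) : IsPreconnected (U ∩ W) := by
  classical
  rw [isPreconnected_iff_subset_of_disjoint]
  intro u v hu hv hsub hdisj
  by_contra! hcon
  obtain ⟨⟨q, hq, hqu⟩, ⟨p, hp, hpv⟩⟩ :=
    And.intro (not_subset.1 hcon.1) (not_subset.1 hcon.2)
  set P : Set E := U ∩ W ∩ u
  have hpP : p ∈ P := ⟨hp, (hsub hp).resolve_right hpv⟩
  have hqP : q ∉ P := fun h => hqu h.2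
  have hPo : IsOpen P := (hU.inter hW).inter hu
  have hfr : ∀ a ∈ frontier P, a ∈ U → a ∉ W := by
    intro a ha haU haW
    have haP : a ∉ P := by
      rw [hPo.frontier_eq] at ha
      exact ha.2
    have hav : a ∈ v := (hsub ⟨haU, haW⟩).resolve_left fun h => haP ⟨⟨haU, haW⟩, h⟩
    obtain ⟨b, hbv, hbP⟩ := mem_closure_iff.1 (frontier_subset_closure ha) v hv hav
    have : b ∈ U ∩ W ∩ (u ∩ v) := ⟨hbP.1, hbP.2, hbv⟩
    rw [hdisj] at this
    exact this
  obtain ⟨φ, hφ0, hφ1, -⟩ := exists_continuous_zero_one_of_isClosed hW.isClosed_compl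
    hU.isClosed_compl (disjoint_left.2 fun x hxW hxU =>
      ((hUW ▸ mem_univ x : x ∈ U ∪ W).elim hxU hxW))
  have hzero : ∀ a ∉ W, φ a = 0 := fun a ha => hφ0 ha
  have hone : ∀ a ∉ U, φ a = 1 := fun a ha => hφ1 ha
  have hf : Continuous fun x => if x ∈ P then ((φ x : ℝ) : AddCircle (1 : ℝ)) else 0 := by
    refine Continuous.if (fun a ha => ?_)
      ((AddCircle.continuous_mk' (1 : ℝ)).comp φ.continuous) continuous_const
    by_cases haU : a ∈ U
    · rw [hzero a (hfr a ha haU)]; simp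
    · rw [hone a haU]; exact AddCircle.coe_period 1
  obtain ⟨e₀, he₀⟩ := QuotientAddGroup.mk_surjective
    (if p ∈ P then ((φ p : ℝ) : AddCircle (1 : ℝ)) else 0)
  obtain ⟨θ, ⟨-, hθ⟩, -⟩ := (AddCircle.isCoveringMap_coe (1 : ℝ)).existsUnique_continuousMap_lifts
    ⟨_, hf⟩ p e₀ he₀
  have hθ' : ∀ x, ((θ x : ℝ) : AddCircle (1 : ℝ)) =
      if x ∈ P then ((φ x : ℝ) : AddCircle (1 : ℝ)) else 0 := fun x => congrFun hθ x
  have key : ∀ (S : Set E) (c : ℝ), IsPreconnected S → (c : AddCircle (1 : ℝ)) = 0 →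
      (∀ a ∈ S, a ∈ frontier P → φ a = c) → p ∈ S → q ∈ S →
      θ p - φ p = θ q - c := by
    intro S c hS hc hfrS hpS hqS
    have hcont : ContinuousOn (fun x => θ x - if x ∈ P then φ x else c) S := by
      refine θ.continuous.continuousOn.sub (ContinuousOn.if (fun a ha => hfrS a ha.1 ha.2)
        φ.continuous.continuousOn continuousOn_const)
    have hmaps : MapsTo (fun x => θ x - if x ∈ P then φ x else c) S
        (AddSubgroup.zmultiples (1 : ℝ) : Set ℝ) := by
      intro x _
      refine (QuotientAddGroup.eq_zero_iff _).1 ?_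
      rw [QuotientAddGroup.mk_sub]
      refine sub_eq_zero.2 ((hθ' x).trans ?_)
      split_ifs
      · rfl
      · exact hc.symm
    have := hS.constant_of_mapsTo (isDiscrete_iff_discreteTopology.2
      (inferInstanceAs (DiscreteTopology (AddSubgroup.zmultiples (1 : ℝ))))) hcont hmaps hpS hqS
    simpa [hpP, hqP] using this
  have h0 := key U 0 hUc (by simp) (fun a haU ha => hzero a (hfr a ha haU)) hp.1 hq.1
  have h1 := key W 1 hWc (AddCircle.coe_period 1)
    (fun a haW ha => hone a fun haU => hfr a ha haU haW) hp.2 hq.2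
  linarith

theorem isPreconnected_compl_closedBall_zero {E : Type*} [NormedAddCommGroup E] [NormedSpace ℝ E]
    (h : 1 < Module.rank ℝ E) {r : ℝ} (hr : 0 ≤ r) :
    IsPreconnected (closedBall (0 : E) r)ᶜ := by
  have himage : (closedBall (0 : E) r)ᶜ =
      (fun q : ℝ × E => q.1 • q.2) '' (Ioi r ×ˢ sphere (0 : E) 1) := by
    ext x
    simp only [mem_compl_iff, mem_closedBall, dist_zero_right, not_le, mem_image, mem_prod,
      mem_Ioi, mem_sphere_iff_norm, sub_zero, Prod.exists]
    constructor
    · intro hx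
      have hx0 : ‖x‖ ≠ 0 := (hr.trans_lt hx).ne'
      exact ⟨‖x‖, ‖x‖⁻¹ • x, ⟨hx, by simp [norm_smul, hx0]⟩, by simp [smul_smul, hx0]⟩
    · rintro ⟨t, y, ⟨ht, hy⟩, rfl⟩
      rwa [norm_smul, hy, mul_one, Real.norm_of_nonneg (hr.trans ht.le)]
  rw [himage]
  exact (isPreconnected_Ioi.prod (isPreconnected_sphere h 0 1)).image _
    continuous_smul.continuousOn

/-- Connected components of a set are relatively closed in it. -/
theorem closure_connectedComponentIn_inter_subset {X : Type*} [TopologicalSpace X] (G : Set X)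
    (x : X) : closure (connectedComponentIn G x) ∩ G ⊆ connectedComponentIn G x := by
  rintro y ⟨hy, hyG⟩
  have hx : x ∈ G := by
    by_contra h
    simp [connectedComponentIn_eq_empty h] at hy
  have : IsPreconnected (insert y (connectedComponentIn G x)) :=
    isPreconnected_connectedComponentIn.subset_closure (subset_insert _ _)
      (insert_subset hy subset_closure)
  exact this.subset_connectedComponentIn (mem_insert_of_mem _ (mem_connectedComponentIn hx))
    (insert_subset hyG (connectedComponentIn_subset G x)) (mem_insert _ _)

/-- An open set with the separation properties of an open ball in `ℝⁿ`, `n ≥ 2`: it is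
unicoherent, and has one end. -/
structure IsBallLike {X : Type*} [TopologicalSpace X] (B : Set X) : Prop where
  isOpen : IsOpen B
  unicoherent : ∀ U W : Set X, IsOpen U → IsOpen W → IsPreconnected U → IsPreconnected W →
    U ∪ W = B → IsPreconnected (U ∩ W)
  one_ended : ∀ K : Set X, IsCompact K → K ⊆ B →
    ∃ C, IsCompact C ∧ K ⊆ C ∧ C ⊆ B ∧ IsPreconnected (B \ C)

theorem Topology.IsOpenEmbedding.isBallLike_range {E X : Type*} [NormedAddCommGroup E]
    [NormedSpace ℝ E] [ProperSpace E] (h : 1 < Module.rank ℝ E) [TopologicalSpace X] {j : E → X}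
    (hj : IsOpenEmbedding j) : IsBallLike (range j) where
  isOpen := hj.isOpen_range
  unicoherent U W hU hW hUc hWc hUW := by
    have hUr : U ⊆ range j := hUW ▸ subset_union_left
    have hWr : W ⊆ range j := hUW ▸ subset_union_right
    have := isPreconnected_inter_of_union_eq_univ (hU.preimage hj.continuous)
      (hW.preimage hj.continuous) (hUc.preimage_of_isOpenMap hj.injective hj.isOpenMap hUr)
      (hWc.preimage_of_isOpenMap hj.injective hj.isOpenMap hWr)
      (by rw [← preimage_union, hUW, preimage_range])
    rw [← preimage_inter] at this
    have himage := this.image j hj.continuous.continuousOn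
    rwa [image_preimage_eq_of_subset (inter_subset_left.trans hUr)] at himage
  one_ended K hK hKB := by
    have hpre : IsCompact (j ⁻¹' K) := by
      rwa [hj.isInducing.isCompact_iff, image_preimage_eq_of_subset hKB]
    obtain ⟨r, hr⟩ := hpre.isBounded.subset_closedBall 0
    refine ⟨j '' closedBall 0 (max r 0), (isCompact_closedBall _ _).image hj.continuous, ?_,
      image_subset_range _ _, ?_⟩
    · rw [← image_preimage_eq_of_subset hKB]
      exact image_mono (hr.trans (closedBall_subset_closedBall (le_max_left _ _)))
    · rw [← image_univ, ← image_sdiff hj.injective, ← compl_eq_univ_sdiff]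
      exact (isPreconnected_compl_closedBall_zero h (le_max_right _ _)).image _
        hj.continuous.continuousOn

section

variable {M : Type*} [TopologicalSpace M] [LocallyConnectedSpace M]

theorem IsBallLike.isPreconnected_connectedComponentIn_inter [T2Space M] {B K : Set M} (hB : IsBallLike B)
    (hK : IsCompact K) (hKB : K ⊆ B) (x : M) :
    IsPreconnected (connectedComponentIn Kᶜ x ∩ B) := by
  set V := connectedComponentIn Kᶜ x with hV
  have hVo : IsOpen V := hK.isClosed.isOpen_compl.connectedComponentIn
  obtain ⟨C, hC, hKC, hCB, hT⟩ := hB.one_ended K hK hKB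
  have hVC : ∀ t ∈ B \ C, t ∈ V → B \ C ⊆ V := fun t ht htV => by
    rw [hV, connectedComponentIn_eq htV]
    exact hT.subset_connectedComponentIn ht fun y hy hyK => hy.2 (hKC hyK)
  by_cases hall : ∃ y ∈ V ∩ B, Disjoint (connectedComponentIn (V ∩ B) y) (B \ C)
  · obtain ⟨y, hy, hdisj⟩ := hall
    set D := connectedComponentIn (V ∩ B) y
    have hDC : closure D ⊆ C := closure_minimal (fun z hz => by
      by_contra hzC
      exact disjoint_left.1 hdisj hz ⟨(connectedComponentIn_subset _ _ hz).2, hzC⟩) hC.isClosed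
    have hVD : V ⊆ D := isPreconnected_connectedComponentIn.subset_of_closure_inter_subset
      (hVo.inter hB.isOpen).connectedComponentIn ⟨y, hy.1, mem_connectedComponentIn hy⟩
      fun z hz => closure_connectedComponentIn_inter_subset _ _
        ⟨hz.1, hz.2, hCB (hDC hz.1)⟩
    have : V ∩ B = D := (inter_subset_left.trans hVD).antisymm (connectedComponentIn_subset _ _)
    rw [this]
    exact isPreconnected_connectedComponentIn
  · simp only [not_exists, not_and, not_disjoint_iff] at hall
    refine isPreconnected_of_forall_pair fun y hy z hz => ?_
    obtain ⟨a, ha, haT⟩ := hall y hy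
    obtain ⟨b, hb, hbT⟩ := hall z hz
    have haV := connectedComponentIn_subset _ _ ha
    have hTV : B \ C ⊆ V ∩ B := subset_inter (hVC a haT haV.1) sdiff_subset
    have hab : b ∈ connectedComponentIn (V ∩ B) a := hT.subset_connectedComponentIn haT hTV hbT
    refine ⟨connectedComponentIn (V ∩ B) y, connectedComponentIn_subset _ _,
      mem_connectedComponentIn hy, ?_, isPreconnected_connectedComponentIn⟩
    rw [connectedComponentIn_eq ha, connectedComponentIn_eq hab, ← connectedComponentIn_eq hb]
    exact mem_connectedComponentIn hz

theorem connectedComponentIn_compl_inter_nonempty [PreconnectedSpace M] {K N : Set M} (hK : IsClosed K)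
    (hKne : K.Nonempty) (hN : IsOpen N) (hKN : K ⊆ N) {x : M} (hx : x ∈ Kᶜ) :
    (connectedComponentIn Kᶜ x ∩ N).Nonempty := by
  by_contra hne
  rw [not_nonempty_iff_eq_empty, ← disjoint_iff_inter_eq_empty] at hne
  have huniv : (univ : Set M) ⊆ connectedComponentIn Kᶜ x :=
    isPreconnected_univ.subset_of_closure_inter_subset hK.isOpen_compl.connectedComponentIn
      ⟨x, trivial, mem_connectedComponentIn hx⟩ fun z hz =>
        closure_connectedComponentIn_inter_subset _ _
          ⟨hz.1, fun hzK => disjoint_left.1 (hne.closure_left hN) hz.1 (hKN hzK)⟩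
  obtain ⟨k, hk⟩ := hKne
  exact connectedComponentIn_subset _ _ (huniv (mem_univ k)) hk

variable [T2Space M] [PreconnectedSpace M]

theorem IsBallLike.isPreconnected_connectedComponentIn_inter_nhds {B K N : Set M}
    (hB : IsBallLike B) (hK : IsCompact K) (hKne : K.Nonempty) (hN : IsOpen N)
    (hNc : IsPreconnected N) (hKN : K ⊆ N) (hNB : N ⊆ B) (x : M) :
    IsPreconnected (connectedComponentIn Kᶜ x ∩ N) := by
  set V := connectedComponentIn Kᶜ x with hV
  have hcomp : ∀ y, IsOpen (connectedComponentIn Kᶜ y ∩ B) := fun y =>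
    hK.isClosed.isOpen_compl.connectedComponentIn.inter hB.isOpen
  obtain ⟨k, hk⟩ := hKne
  let W : Set M := N ∪ ⋃ y ∈ B \ (V ∪ K), (connectedComponentIn Kᶜ y ∩ B)
  have hWo : IsOpen W := hN.union (isOpen_biUnion fun y _ => hcomp y)
  have hWc : IsPreconnected W := by
    refine isPreconnected_of_forall k fun y hy => ?_
    rcases hy with hy | hy
    · exact ⟨N, subset_union_left, hKN hk, hy, hNc⟩
    · obtain ⟨z, hz, hyz⟩ := mem_iUnion₂.1 hy
      obtain ⟨w, hw, hwN⟩ := connectedComponentIn_compl_inter_nonempty hK.isClosed ⟨k, hk⟩ hN hKN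
        (fun h => hz.2 (Or.inr h) : z ∈ Kᶜ)
      exact ⟨N ∪ (connectedComponentIn Kᶜ z ∩ B),
        union_subset_union_right _ (subset_biUnion_of_mem (u := fun z =>
          connectedComponentIn Kᶜ z ∩ B) hz), Or.inl (hKN hk), Or.inr hyz,
        hNc.union w hwN ⟨hw, hNB hwN⟩ (hB.isPreconnected_connectedComponentIn_inter hK
          (hKN.trans hNB) z)⟩
  have hcover : (V ∩ B) ∪ W = B := by
    refine Subset.antisymm (union_subset inter_subset_right (union_subset hNB
      (iUnion₂_subset fun _ _ => inter_subset_right))) fun y hy => ?_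
    by_cases hyV : y ∈ V
    · exact Or.inl ⟨hyV, hy⟩
    by_cases hyK : y ∈ K
    · exact Or.inr (Or.inl (hKN hyK))
    · have hmem : y ∈ B \ (V ∪ K) := ⟨hy, fun h => h.elim hyV hyK⟩
      exact Or.inr (Or.inr (mem_biUnion hmem ⟨mem_connectedComponentIn hyK, hy⟩))
  have hinter : (V ∩ B) ∩ W = V ∩ N := by
    ext y
    constructor
    · rintro ⟨⟨hyV, -⟩, hyN | hy⟩
      · exact ⟨hyV, hyN⟩
      · obtain ⟨z, hz, hyz, -⟩ := mem_iUnion₂.1 hy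
        refine absurd (Or.inl ?_) hz.2
        rw [hV, connectedComponentIn_eq hyV, ← connectedComponentIn_eq hyz]
        exact mem_connectedComponentIn fun h => hz.2 (Or.inr h)
    · rintro ⟨hyV, hyN⟩
      exact ⟨⟨hyV, hNB hyN⟩, Or.inl hyN⟩
  rw [← hinter]
  exact hB.unicoherent _ _ (hcomp x) hWo
    (hB.isPreconnected_connectedComponentIn_inter hK (hKN.trans hNB) x) hWc hcover

/-- If neither a closed set `A` nor a disjoint continuum `K` inside a ball-like set separates
`x₁` and `x₂`, then `A ∪ K` does not separate them either. -/
theorem IsBallLike.mem_connectedComponentIn_compl_union {B K A : Set M} (hB : IsBallLike B)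
    (hA : IsClosed A) (hK : IsCompact K) (hKc : IsConnected K) (hKB : K ⊆ B)
    (hAK : Disjoint A K) {x₁ x₂ : M} (hxA : x₂ ∈ connectedComponentIn Aᶜ x₁)
    (hxK : x₂ ∈ connectedComponentIn Kᶜ x₁) : x₂ ∈ connectedComponentIn (A ∪ K)ᶜ x₁ := by
  obtain ⟨k, hk⟩ := hKc.nonempty
  have hKBA : K ⊆ B \ A := fun y hy => ⟨hKB hy, disjoint_right.1 hAK hy⟩
  set N := connectedComponentIn (B \ A) k
  have hN : IsOpen N := (hB.isOpen.sdiff hA).connectedComponentIn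
  have hKN : K ⊆ N := hKc.isPreconnected.subset_connectedComponentIn hk hKBA
  have hNBA : N ⊆ B \ A := connectedComponentIn_subset _ _
  have hVN := hB.isPreconnected_connectedComponentIn_inter_nhds hK ⟨k, hk⟩ hN
    isPreconnected_connectedComponentIn hKN (hNBA.trans sdiff_subset) x₁
  have hx₁A : x₁ ∈ Aᶜ := connectedComponentIn_nonempty_iff.1 ⟨_, hxA⟩
  have hx₁K : x₁ ∈ Kᶜ := connectedComponentIn_nonempty_iff.1 ⟨_, hxK⟩
  have hx₂A := connectedComponentIn_subset _ _ hxA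
  have hx₂K := connectedComponentIn_subset _ _ hxK
  have hmem : ∀ {x}, x ∈ Aᶜ → x ∈ Kᶜ → x ∈ (A ∪ K)ᶜ := fun hA hK h => h.elim hA hK
  have dich : ∀ x ∈ Aᶜ, x ∈ connectedComponentIn Kᶜ x₁ →
      connectedComponentIn Aᶜ x ⊆ connectedComponentIn (A ∪ K)ᶜ x ∨
      ((connectedComponentIn Kᶜ x₁ ∩ N).Nonempty ∧
        connectedComponentIn Kᶜ x₁ ∩ N ⊆ connectedComponentIn (A ∪ K)ᶜ x) := by
    intro x hxA hxV
    have hx := hmem hxA (connectedComponentIn_subset _ _ hxV)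
    by_cases hDN : Disjoint (connectedComponentIn (A ∪ K)ᶜ x) N
    · left
      refine isPreconnected_connectedComponentIn.subset_of_closure_inter_subset
        (hA.union hK.isClosed).isOpen_compl.connectedComponentIn
        ⟨x, mem_connectedComponentIn hxA, mem_connectedComponentIn hx⟩ fun z hz => ?_
      exact closure_connectedComponentIn_inter_subset _ _ ⟨hz.1,
        hmem (connectedComponentIn_subset _ _ hz.2)
          fun hzK => disjoint_left.1 (hDN.closure_left hN) hz.1 (hKN hzK)⟩
    · right
      obtain ⟨w, hw, hwN⟩ := not_disjoint_iff.1 hDN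
      have hwV : w ∈ connectedComponentIn Kᶜ x₁ := by
        rw [connectedComponentIn_eq hxV]
        exact connectedComponentIn_mono x (compl_subset_compl.2 subset_union_right) hw
      refine ⟨⟨w, hwV, hwN⟩, ?_⟩
      rw [connectedComponentIn_eq hw]
      exact hVN.subset_connectedComponentIn ⟨hwV, hwN⟩ fun y hy =>
        hmem (hNBA hy.2).2 (connectedComponentIn_subset _ _ hy.1)
  rcases dich x₁ hx₁A (mem_connectedComponentIn hx₁K) with h₁ | ⟨⟨w, hw⟩, h₁⟩
  · exact h₁ hxA
  rcases dich x₂ hx₂A hxK with h₂ | ⟨-, h₂⟩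
  · have : x₁ ∈ connectedComponentIn (A ∪ K)ᶜ x₂ := h₂ (by
      rw [← connectedComponentIn_eq hxA]
      exact mem_connectedComponentIn hx₁A)
    rw [← connectedComponentIn_eq this]
    exact mem_connectedComponentIn (hmem hx₂A hx₂K)
  · rw [connectedComponentIn_eq (h₁ hw), ← connectedComponentIn_eq (h₂ hw)]
    exact mem_connectedComponentIn (hmem hx₂A hx₂K)

theorem mem_connectedComponentIn_compl_biUnion {s : Finset (Set M)}
    (hs : ∀ K ∈ s, IsCompact K ∧ IsConnected K ∧ ∃ B, IsBallLike B ∧ K ⊆ B)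
    (hdisj : (s : Set (Set M)).Pairwise Disjoint) {x₁ x₂ : M}
    (hx : ∀ K ∈ s, x₂ ∈ connectedComponentIn Kᶜ x₁) :
    x₂ ∈ connectedComponentIn (⋃ K ∈ s, K)ᶜ x₁ := by
  classical
  induction s using Finset.induction_on with
  | empty => simp [connectedComponentIn_univ]
  | insert K t hKt ih =>
    simp only [Finset.forall_mem_insert] at hs hx
    obtain ⟨⟨hK, hKc, B, hB, hKB⟩, ht⟩ := hs
    rw [Finset.coe_insert, pairwise_insert_of_symm] at hdisj
    rw [Finset.set_biUnion_insert, union_comm]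
    refine hB.mem_connectedComponentIn_compl_union
      (t.finite_toSet.isClosed_biUnion fun L hL => (ht L hL).1.isClosed) hK hKc hKB ?_
      (ih ht hdisj.1 hx.2) hx.1
    exact disjoint_iUnion₂_left.2 fun L hL =>
      (hdisj.2 L hL (by rintro rfl; exact hKt hL)).symm

end

/-- The connected components of a finite disjoint union of closed connected sets are its
members. -/
theorem connectedComponentIn_biUnion_eq {X : Type*} [TopologicalSpace X] {s : Finset (Set X)}
    (hcl : ∀ K ∈ s, IsClosed K) (hdisj : (s : Set (Set X)).Pairwise Disjoint) {K : Set X}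
    (hK : K ∈ s) (hKc : IsPreconnected K) {a : X} (ha : a ∈ K) :
    connectedComponentIn (⋃ L ∈ s, L) a = K := by
  classical
  have hKs : K ⊆ ⋃ L ∈ s, L := subset_biUnion_of_mem (u := fun L : Set X => L) hK
  refine Subset.antisymm ?_ (hKc.subset_connectedComponentIn ha hKs)
  let R : Set X := ⋃ L ∈ s.erase K, L
  have hR : IsClosed R := (s.erase K).finite_toSet.isClosed_biUnion fun L hL =>
    hcl L (Finset.mem_of_mem_erase hL)
  have hKR : K ∩ R = ∅ := by
    refine disjoint_iff_inter_eq_empty.1 (disjoint_iUnion₂_right.2 fun L hL => ?_)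
    exact hdisj hK (Finset.mem_of_mem_erase hL) (Finset.ne_of_mem_erase hL).symm
  have hsub : connectedComponentIn (⋃ L ∈ s, L) a ⊆ K ∪ R := by
    refine (connectedComponentIn_subset _ _).trans (iUnion₂_subset fun L hL => ?_)
    by_cases hLK : L = K
    · exact hLK ▸ subset_union_left
    · exact (subset_biUnion_of_mem (u := fun L : Set X => L)
        (Finset.mem_erase.2 ⟨hLK, hL⟩)).trans subset_union_right
  refine ((isPreconnected_iff_subset_of_disjoint_closed.1
    (isPreconnected_connectedComponentIn (x := a) (F := ⋃ L ∈ s, L))) K R (hcl K hK) hR hsub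
    (by rw [hKR, inter_empty])).resolve_right fun h => ?_
  have : a ∈ K ∩ R := ⟨ha, h (mem_connectedComponentIn (hKs ha))⟩
  rwa [hKR] at this

theorem exists_mem_isBallLike_of_chartedSpace {E X : Type*} [NormedAddCommGroup E]
    [InnerProductSpace ℝ E] [ProperSpace E] (h : 1 < Module.rank ℝ E) [TopologicalSpace X]
    [ChartedSpace E X] (x : X) : ∃ B : Set X, x ∈ B ∧ IsBallLike B := by
  let e := chartAt E x
  obtain ⟨r, hr, hball⟩ := Metric.isOpen_iff.1 e.open_target (e x) (mem_chart_target E x)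
  let g := OpenPartialHomeomorph.univBall (e x) r
  have hgt : g.target = ball (e x) r := OpenPartialHomeomorph.univBall_target _ hr
  let f := g.trans e.symm
  have hfs : f.source = univ := by
    refine eq_univ_of_forall fun y => ?_
    have hy : y ∈ g.source := by simp [g]
    exact ⟨hy, hball (hgt ▸ g.map_source hy)⟩
  refine ⟨range f, ⟨0, ?_⟩, (f.isOpenEmbedding hfs).isBallLike_range h⟩
  simp [f, g, e]

/-- every connected metric `n`-manifold with `n ≥ 2` satisfies separation
axiom S. -/
theorem axiomS_of_manifold (n : ℕ) (hn : 2 ≤ n)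
    (X : Type*) [MetricSpace X] [ChartedSpace (EuclideanSpace ℝ (Fin n)) X]
    [ConnectedSpace X] :
    AxiomS X := by
  have hrank : 1 < Module.rank ℝ (EuclideanSpace ℝ (Fin n)) := by
    rw [← Module.finrank_eq_rank, finrank_euclideanSpace_fin]
    exact_mod_cast hn
  have : LocallyConnectedSpace X :=
    ChartedSpace.locallyConnectedSpace (EuclideanSpace ℝ (Fin n)) X
  choose B hxB hB using exists_mem_isBallLike_of_chartedSpace (X := X) hrank
  intro F hF
  obtain ⟨δ, hδ, hleb⟩ := lebesgue_number_lemma_of_metric hF (c := B) (fun x => (hB x).isOpen)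
    fun x _ => mem_iUnion.2 ⟨x, hxB x⟩
  refine ⟨δ, hδ, ?_⟩
  rintro s A rfl hAF hs hdisj x₁ x₂ ⟨hx₁, hx₂, hsep⟩
  by_contra! hcon
  refine hsep (mem_connectedComponentIn_compl_biUnion (fun K hK => ?_) hdisj fun K hK => ?_)
  · obtain ⟨⟨hKcpt, hKc⟩, hdiam⟩ := hs K hK
    obtain ⟨a, ha⟩ := hKc.nonempty
    obtain ⟨i, hi⟩ := hleb a (hAF (mem_biUnion hK ha))
    refine ⟨hKcpt, hKc, B i, hB i, fun y hy => hi ?_⟩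
    rw [mem_ball, ← ENNReal.ofReal_lt_ofReal_iff hδ, ← edist_dist]
    exact (Metric.edist_le_ediam_of_mem hy ha).trans_lt hdiam
  · obtain ⟨a, ha⟩ := (hs K hK).1.2.nonempty
    have hKs : K ⊆ ⋃ L ∈ s, L := subset_biUnion_of_mem (u := fun L : Set X => L) hK
    by_contra hK₂
    refine hcon K ⟨a, hKs ha, (connectedComponentIn_biUnion_eq
      (fun L hL => (hs L hL).1.1.isClosed) hdisj hK (hs K hK).1.2.isPreconnected ha).symm⟩
      ⟨fun h => hx₁ (hKs h), fun h => hx₂ (hKs h), hK₂⟩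
end
end
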